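/- arXiv:2503.08274 — 3 statements merged into one kernel-verified Lean document; each statement's English description precedes it below -/
import Mathlib

section
/- Let 0 < β < 1, a < 0, δ < 0. Then for every t > 0 the value of the bivariate Mittag-Leffler type function with parameters (β,1,β; 0,1; β,1,β+1; β,β; 1,1) at the point (a t^β, δ t), namely S(t) = ∑_{m=0}^∞ ∑_{k=0}^∞ [Γ(βm+k+β) / (Γ(β) Γ(βm+k+β+1))] · (a t^β)^m/Γ(βm+β) · (δ t)^k/k!, is strictly positive: S(t) > 0. -/
/-- The value of the bivariate Mittag-Leffler type function with parameters
`(β,1,β; 0,1; β,1,β+1; β,β; 1,1)` at the point `(a t^β, δ t)`: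
`S(t) = ∑_{m,k} [Γ(βm+k+β)/(Γ(β) Γ(βm+k+β+1))] ⬝ (a t^β)^m/Γ(βm+β) ⬝ (δ t)^k/k!`. -/
noncomputable def bivMLS (β a δ t : ℝ) : ℝ :=
  ∑' mk : ℕ × ℕ,
    Real.Gamma (β * mk.1 + mk.2 + β) /
        (Real.Gamma β * Real.Gamma (β * mk.1 + mk.2 + β + 1)) *
      ((a * t ^ β) ^ mk.1 / Real.Gamma (β * mk.1 + β)) *
      ((δ * t) ^ mk.2 / (Nat.factorial mk.2))

open Filter Topology in
theorem aux_tendsto_pow (x β : ℝ) (hβ : 0 < β) : ∃ N : ℕ, 1 ≤ N ∧ x * ((N : ℝ) ^ β)⁻¹ < 1 := by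
  have h : Tendsto (fun n : ℕ => x * ((n : ℝ) ^ β)⁻¹) atTop (𝓝 (x * 0)) :=
    (((tendsto_rpow_atTop hβ).comp tendsto_natCast_atTop_atTop).inv_tendsto_atTop).const_mul x
  rw [mul_zero] at h
  have h2 := (h.eventually (gt_mem_nhds one_pos)).and (eventually_ge_atTop 1)
  obtain ⟨N, h1, h2⟩ := h2.exists
  exact ⟨N, h2, h1⟩

/-- coefficients of `(1-z)^(-s)` -/
noncomputable def bmlD (n : ℕ) (s : ℝ) : ℝ := (∏ j ∈ Finset.range n, (s + j)) / (n.factorial : ℝ)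

theorem bmlD_zero (s : ℝ) : bmlD 0 s = 1 := by simp [bmlD]

theorem bmlD_succ (n : ℕ) (s : ℝ) : ((n : ℝ) + 1) * bmlD (n + 1) s = (s + n) * bmlD n s := by
  have : (n.factorial : ℝ) ≠ 0 := by positivity
  rw [bmlD, bmlD, Finset.prod_range_succ, Nat.factorial_succ]
  push_cast
  field_simp

theorem bmlD_succ' (n : ℕ) (s : ℝ) : bmlD (n + 1) s = (s + n) / (n + 1) * bmlD n s := by
  have := bmlD_succ n s
  field_simp
  linarith

theorem bmlD_vander (n : ℕ) (a b : ℝ) :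
    ∑ p ∈ Finset.HasAntidiagonal.antidiagonal n, bmlD p.1 a * bmlD p.2 b = bmlD n (a + b) := by
  induction n with
  | zero => simp [bmlD_zero]
  | succ n ih =>
    have hn : ((n : ℝ) + 1) ≠ 0 := by positivity
    apply mul_left_cancel₀ hn
    rw [bmlD_succ, ← ih, Finset.mul_sum, Finset.mul_sum]
    have h1 : ∑ p ∈ Finset.HasAntidiagonal.antidiagonal (n + 1), ((n : ℝ) + 1) * (bmlD p.1 a * bmlD p.2 b)
        = ∑ p ∈ Finset.HasAntidiagonal.antidiagonal (n + 1), ((p.1 : ℝ) * bmlD p.1 a) * bmlD p.2 b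
        + ∑ p ∈ Finset.HasAntidiagonal.antidiagonal (n + 1), bmlD p.1 a * ((p.2 : ℝ) * bmlD p.2 b) := by
      rw [← Finset.sum_add_distrib]
      refine Finset.sum_congr rfl fun p hp => ?_
      have : (p.1 : ℝ) + p.2 = n + 1 := by exact_mod_cast Finset.HasAntidiagonal.mem_antidiagonal.1 hp
      rw [← this]; ring
    rw [h1, Finset.Nat.sum_antidiagonal_succ, Finset.Nat.sum_antidiagonal_succ']
    simp only [Nat.cast_zero, zero_mul, zero_add, mul_zero, Nat.cast_add, Nat.cast_one, bmlD_succ]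
    rw [← Finset.sum_add_distrib]
    refine Finset.sum_congr rfl fun p hp => ?_
    have : (p.1 : ℝ) + p.2 = n := by exact_mod_cast Finset.HasAntidiagonal.mem_antidiagonal.1 hp
    rw [← this]; ring

theorem bmlD_nonneg (n : ℕ) (s : ℝ) (hs : 0 ≤ s) : 0 ≤ bmlD n s := by
  unfold bmlD
  have : 0 ≤ ∏ j ∈ Finset.range n, (s + j) := Finset.prod_nonneg fun j _ => by positivity
  positivity

theorem bmlD_le (n : ℕ) (s : ℝ) (hs : 0 ≤ s) : bmlD n s ≤ (1 + s) ^ n := by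
  induction n with
  | zero => simp [bmlD_zero]
  | succ n ih =>
    rw [bmlD_succ', pow_succ, mul_comm]
    have : (s + n) / (n + 1) ≤ 1 + s := by
      rw [div_le_iff₀ (by positivity)]
      have : 0 ≤ s * n := by positivity
      linarith
    have h0 := bmlD_nonneg n s hs
    gcongr

theorem bmlD_neg (β : ℝ) (h0 : 0 < β) (h1 : β < 1) (n : ℕ) : bmlD (n + 1) (-β) ≤ 0 := by
  induction n with
  | zero => simp [bmlD_succ', bmlD_zero, h0.le]
  | succ n ih =>
    rw [bmlD_succ']
    have h : (0 : ℝ) ≤ n := by positivity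
    refine mul_nonpos_of_nonneg_of_nonpos ?_ ih
    push_cast
    apply div_nonneg <;> linarith

theorem bml_summ (β q : ℝ) (h0 : 0 < β) (h1 : β < 1) (hq : 0 < q) (hq1 : q < 1) (N : ℕ) :
    Summable fun m : ℕ => (1 + β * ((m : ℝ) + 1)) ^ N * q ^ m := by
  have h := summable_pow_mul_geometric_of_norm_lt_one (R := ℝ) N (r := q)
    (by rwa [Real.norm_of_nonneg hq.le])
  have h2 := ((summable_nat_add_iff 2).2 h).mul_left (q ^ 2)⁻¹
  refine Summable.of_nonneg_of_le (fun m => by positivity) (fun m => ?_) h2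
  have e : (q ^ 2)⁻¹ * ((((m + 2 : ℕ) : ℝ)) ^ N * q ^ (m + 2)) = ((m : ℝ) + 2) ^ N * q ^ m := by
    push_cast
    rw [pow_add]; field_simp
  rw [e]
  have : 1 + β * ((m : ℝ) + 1) ≤ m + 2 := by
    have : β * ((m : ℝ) + 1) ≤ 1 * ((m : ℝ) + 1) := by gcongr
    linarith
  gcongr

theorem bml_p_summ (β y : ℝ) (h0 : 0 < β) (h1 : β < 1) (hy : 0 < y) (hy1 : y < 1) (n : ℕ) :
    Summable fun m : ℕ => (-y) ^ m * bmlD n (β * ((m : ℝ) + 1)) := by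
  refine Summable.of_norm_bounded (bml_summ β y h0 h1 hy hy1 n) fun m => ?_
  have hs : 0 ≤ β * ((m : ℝ) + 1) := by positivity
  rw [norm_mul, norm_pow, norm_neg, Real.norm_of_nonneg hy.le,
    Real.norm_of_nonneg (bmlD_nonneg n _ hs), mul_comm]
  gcongr
  exact bmlD_le n _ hs

theorem bml_p_nonneg (β y : ℝ) (h0 : 0 < β) (h1 : β < 1) (hy : 0 < y) (hy1 : y < 1) (n : ℕ) :
    0 ≤ ∑' m : ℕ, (-y) ^ m * bmlD n (β * ((m : ℝ) + 1)) := by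
  set p : ℕ → ℝ := fun n => ∑' m : ℕ, (-y) ^ m * bmlD n (β * ((m : ℝ) + 1)) with hp
  change 0 ≤ p n
  have S := bml_p_summ β y h0 h1 hy hy1
  have key : ∀ n, ∑ q ∈ Finset.HasAntidiagonal.antidiagonal n, bmlD q.1 (-β) * p q.2 = bmlD n 0 - y * p n := by
    intro n
    have e1 : ∀ q ∈ Finset.HasAntidiagonal.antidiagonal n, bmlD q.1 (-β) * p q.2 =
        ∑' m : ℕ, bmlD q.1 (-β) * ((-y) ^ m * bmlD q.2 (β * ((m : ℝ) + 1))) := by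
      intro q _
      exact tsum_mul_left.symm
    have e0 : ∀ q ∈ Finset.HasAntidiagonal.antidiagonal n,
        Summable fun m : ℕ => bmlD q.1 (-β) * ((-y) ^ m * bmlD q.2 (β * ((m : ℝ) + 1))) :=
      fun q _ => (S q.2).mul_left (bmlD q.1 (-β))
    rw [Finset.sum_congr rfl e1, ← Summable.tsum_finsetSum e0]
    have e2 : ∀ m : ℕ, ∑ q ∈ Finset.HasAntidiagonal.antidiagonal n,
        bmlD q.1 (-β) * ((-y) ^ m * bmlD q.2 (β * ((m : ℝ) + 1))) =
        (-y) ^ m * bmlD n (β * m) := by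
      intro m
      have : β * (m : ℝ) = -β + β * ((m : ℝ) + 1) := by ring
      rw [this, ← bmlD_vander, Finset.mul_sum]
      exact Finset.sum_congr rfl fun q _ => by ring
    rw [tsum_congr e2]
    have e3 : Summable fun m : ℕ => (-y) ^ m * bmlD n (β * m) := by
      rw [← summable_nat_add_iff 1]
      refine ((S n).mul_left (-y)).congr fun m => ?_
      push_cast; ring
    rw [e3.tsum_eq_zero_add]
    have e4 : ∀ m : ℕ, (-y) ^ (m + 1) * bmlD n (β * ((m + 1 : ℕ) : ℝ)) =
        (-y) * ((-y) ^ m * bmlD n (β * ((m : ℝ) + 1))) := by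
      intro m; push_cast; ring
    rw [tsum_congr e4, tsum_mul_left]
    simp [hp]; ring
  have hd0 : ∀ n, 0 ≤ bmlD n 0 := fun n => bmlD_nonneg n 0 le_rfl
  induction n using Nat.strong_induction_on with
  | _ n ih =>
    have k := key n
    cases n with
    | zero =>
      simp [bmlD_zero] at k
      by_contra h
      push Not at h
      nlinarith
    | succ n =>
      rw [Finset.Nat.sum_antidiagonal_succ] at k
      simp only [bmlD_zero, one_mul] at k
      have : ∑ q ∈ Finset.HasAntidiagonal.antidiagonal n, bmlD (q.1 + 1) (-β) * p q.2 ≤ 0 := by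
        refine Finset.sum_nonpos fun q hq => ?_
        have hq' := Finset.HasAntidiagonal.mem_antidiagonal.1 hq
        exact mul_nonpos_of_nonpos_of_nonneg (bmlD_neg β h0 h1 _) (ih q.2 (by omega))
      have h3 := hd0 (n + 1)
      by_contra h
      push Not at h
      nlinarith

theorem bmlD_anti (s : ℝ) (hs : 0 < s) (N n : ℕ) (hN : 1 ≤ N) (hn : N ≤ n) :
    (s + n) * bmlD n s / (n : ℝ) ^ s ≤ (s + N) * bmlD N s / (N : ℝ) ^ s := by
  induction n, hn using Nat.le_induction with
  | base => exact le_rfl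
  | succ n hn ih =>
    refine le_trans ?_ ih
    have hn0 : (0 : ℝ) < n := by exact_mod_cast (by omega : 0 < n)
    have hD := bmlD_nonneg n s hs.le
    have k : (1 + s / (n + 1)) ≤ (((n : ℝ) + 1) / n) ^ s := by
      rw [Real.rpow_def_of_pos (by positivity)]
      refine le_trans ?_ (Real.add_one_le_exp _)
      have := Real.one_sub_inv_le_log_of_pos (x := ((n : ℝ) + 1) / n) (by positivity)
      have e : 1 - (((n : ℝ) + 1) / n)⁻¹ = 1 / (n + 1) := by field_simp; ring
      rw [e] at this
      have := mul_le_mul_of_nonneg_right this hs.le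
      have e2 : 1 / ((n : ℝ) + 1) * s = s / (n + 1) := by ring
      linarith
    rw [Real.div_rpow (by positivity) hn0.le, le_div_iff₀ (by positivity)] at k
    rw [div_le_div_iff₀ (by positivity) (by positivity), bmlD_succ']
    push_cast
    have := mul_le_mul_of_nonneg_left k (mul_nonneg (by positivity : 0 ≤ s + n) hD)
    refine le_trans (le_of_eq ?_) this
    field_simp
    ring

theorem bmlT_bound (s : ℝ) (hs : 0 < s) (N n : ℕ) (hN : 1 ≤ N) (hn : N ≤ n) :
    n * bmlD n s / (n : ℝ) ^ s ≤ N * (1 + s) ^ (N + 1) * ((N : ℝ) ^ s)⁻¹ := by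
  have hD := bmlD_nonneg n s hs.le
  have hN' : (1 : ℝ) ≤ N := by exact_mod_cast hN
  calc n * bmlD n s / (n : ℝ) ^ s ≤ (s + n) * bmlD n s / (n : ℝ) ^ s := by
        gcongr; linarith
    _ ≤ _ := bmlD_anti s hs N n hN hn
    _ ≤ (N * (1 + s)) * (1 + s) ^ N / (N : ℝ) ^ s := by
        have := bmlD_le N s hs.le
        have h2 : s + N ≤ N * (1 + s) := by nlinarith
        have := bmlD_nonneg N s hs.le
        gcongr
    _ = _ := by rw [pow_succ]; ring

open Filter Topology in
theorem bmlT_tendsto (s : ℝ) (hs : 0 < s) :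
    Tendsto (fun n : ℕ => n * bmlD n s / (n : ℝ) ^ s) atTop (𝓝 (1 / Real.Gamma s)) := by
  have h1 := (Real.GammaSeq_tendsto_Gamma s).inv₀ (Real.Gamma_pos_of_pos hs).ne'
  have h2 := tendsto_natCast_div_add_atTop (𝕜 := ℝ) s
  have h3 := h2.mul h1
  rw [one_mul, ← one_div] at h3
  refine h3.congr' ?_
  filter_upwards [eventually_ge_atTop 1] with n hn
  have hn0 : (0 : ℝ) < n := by exact_mod_cast (by omega : 0 < n)
  rw [Real.GammaSeq, bmlD, Finset.prod_range_succ]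
  have : (0 : ℝ) < ∏ j ∈ Finset.range n, (s + j) := Finset.prod_pos fun j _ => by positivity
  have h4 : s + n ≠ 0 := by positivity
  have h5 : (n : ℝ) + s ≠ 0 := by positivity
  have h6 : (n : ℝ) ^ s ≠ 0 := by positivity
  field_simp
  ring

/-- The Mittag-Leffler series has a summable majorant valid for the approximations too. -/
theorem bml_major (β x : ℝ) (h0 : 0 < β) (h1 : β < 1) (hx : 0 < x) :
    ∃ (N : ℕ) (B : ℕ → ℝ), 1 ≤ N ∧ Summable B ∧ ∀ n, N ≤ n → ∀ m : ℕ,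
      x ^ m * (n * bmlD n (β * ((m : ℝ) + 1)) / (n : ℝ) ^ (β * ((m : ℝ) + 1))) ≤ B m := by
  obtain ⟨N, hN, hq⟩ := aux_tendsto_pow x β h0
  have hN0 : (0 : ℝ) < N := by exact_mod_cast (by omega : 0 < N)
  refine ⟨N, fun m => (N * ((N : ℝ) ^ β)⁻¹) *
    ((1 + β * ((m : ℝ) + 1)) ^ (N + 1) * (x * ((N : ℝ) ^ β)⁻¹) ^ m), hN,
    (bml_summ β _ h0 h1 (by positivity) hq (N + 1)).mul_left _, fun n hn m => ?_⟩
  have := bmlT_bound (β * ((m : ℝ) + 1)) (by positivity) N n hN hn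
  refine (mul_le_mul_of_nonneg_left this (by positivity : 0 ≤ x ^ m)).trans (le_of_eq ?_)
  have e : (N : ℝ) ^ (β * ((m : ℝ) + 1)) = ((N : ℝ) ^ β) ^ m * (N : ℝ) ^ β := by
    rw [Real.rpow_mul hN0.le, ← pow_succ, ← Real.rpow_natCast]; push_cast; rfl
  beta_reduce
  rw [e, mul_pow, mul_inv, inv_pow]
  ring

open Filter Topology in
theorem bml_summable_pos (β x : ℝ) (h0 : 0 < β) (h1 : β < 1) (hx : 0 < x) :
    Summable fun m : ℕ => x ^ m / Real.Gamma (β * m + β) := by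
  obtain ⟨N, B, hN, hB, hb⟩ := bml_major β x h0 h1 hx
  have hs : ∀ m : ℕ, 0 < β * ((m : ℝ) + 1) := fun m => by positivity
  have e : ∀ m : ℕ, β * (m : ℝ) + β = β * ((m : ℝ) + 1) := fun m => by ring
  simp only [e]
  refine Summable.of_nonneg_of_le
    (fun m => div_nonneg (by positivity) (Real.Gamma_pos_of_pos (hs m)).le) (fun m => ?_) hB
  have := (bmlT_tendsto _ (hs m)).const_mul (x ^ m)
  rw [mul_one_div] at this
  refine le_of_tendsto this ?_
  filter_upwards [eventually_ge_atTop N] with n hn using hb n hn m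

open Filter Topology in
theorem bml_nonneg (β x : ℝ) (h0 : 0 < β) (h1 : β < 1) (hx : 0 < x) :
    0 ≤ ∑' m : ℕ, (-x) ^ m / Real.Gamma (β * m + β) := by
  obtain ⟨N, B, hN, hB, hb⟩ := bml_major β x h0 h1 hx
  obtain ⟨M, hM, hq⟩ := aux_tendsto_pow x β h0
  have hs : ∀ m : ℕ, 0 < β * ((m : ℝ) + 1) := fun m => by positivity
  have e : ∀ m : ℕ, β * (m : ℝ) + β = β * ((m : ℝ) + 1) := fun m => by ring
  simp only [e]
  have T : Tendsto (fun n : ℕ => ∑' m : ℕ, (-x) ^ m *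
      (n * bmlD n (β * ((m : ℝ) + 1)) / (n : ℝ) ^ (β * ((m : ℝ) + 1)))) atTop
      (𝓝 (∑' m : ℕ, (-x) ^ m / Real.Gamma (β * ((m : ℝ) + 1)))) := by
    refine tendsto_tsum_of_dominated_convergence hB (fun m => ?_) ?_
    · have := (bmlT_tendsto _ (hs m)).const_mul ((-x) ^ m)
      rwa [mul_one_div] at this
    · filter_upwards [eventually_ge_atTop N] with n hn m
      refine le_trans (le_of_eq ?_) (hb n hn m)
      have := bmlD_nonneg n _ (hs m).le
      rw [norm_mul, norm_pow, norm_neg, Real.norm_of_nonneg hx.le, Real.norm_of_nonneg]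
      positivity
  refine ge_of_tendsto T ?_
  filter_upwards [eventually_ge_atTop M] with n hn
  have hM0 : (0 : ℝ) < M := by exact_mod_cast (by omega : 0 < M)
  have hn0 : (0 : ℝ) < n := by exact_mod_cast (by omega : 0 < n)
  have hy : x * ((n : ℝ) ^ β)⁻¹ < 1 := by
    refine lt_of_le_of_lt ?_ hq
    have : (M : ℝ) ≤ n := by exact_mod_cast hn
    gcongr
  have P := bml_p_nonneg β (x * ((n : ℝ) ^ β)⁻¹) h0 h1 (by positivity) hy n
  have P2 := mul_nonneg (by positivity : 0 ≤ (n : ℝ) * ((n : ℝ) ^ β)⁻¹) P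
  rw [← tsum_mul_left] at P2
  refine P2.trans (le_of_eq (tsum_congr fun m => ?_))
  have e : (n : ℝ) ^ (β * ((m : ℝ) + 1)) = ((n : ℝ) ^ β) ^ m * (n : ℝ) ^ β := by
    rw [Real.rpow_mul hn0.le, ← pow_succ, ← Real.rpow_natCast]; push_cast; rfl
  rw [e, ← neg_mul, mul_pow, inv_pow, div_eq_mul_inv, mul_inv]
  ring

open Filter Topology in
theorem bml_near_zero (β x : ℝ) (h0 : 0 < β) (h1 : β < 1) (hx : 0 < x) :
    ∃ ε : ℝ, 0 < ε ∧ ∀ r, 0 < r → r < ε →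
      0 < ∑' m : ℕ, (-(x * r ^ β)) ^ m / Real.Gamma (β * m + β) := by
  have hG : ∀ m : ℕ, 0 < Real.Gamma (β * m + β) := fun m => Real.Gamma_pos_of_pos (by positivity)
  have hc : Tendsto (fun r : ℝ => -(x * r ^ β)) (𝓝 0) (𝓝 0) := by
    have : ContinuousAt (fun r : ℝ => -(x * r ^ β)) 0 :=
      ((Real.continuousAt_rpow_const 0 β (Or.inr h0.le)).const_mul x).neg
    simpa [ContinuousAt, Real.zero_rpow h0.ne'] using this
  have T : Tendsto (fun r : ℝ => ∑' m : ℕ, (-(x * r ^ β)) ^ m / Real.Gamma (β * m + β)) (𝓝 0)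
      (𝓝 (∑' m : ℕ, (0 : ℝ) ^ m / Real.Gamma (β * m + β))) := by
    refine tendsto_tsum_of_dominated_convergence (bml_summable_pos β 1 h0 h1 one_pos)
      (fun m => (hc.pow m).div_const _) ?_
    have := hc.norm
    rw [norm_zero] at this
    filter_upwards [this.eventually (gt_mem_nhds one_pos)] with r hr m
    rw [norm_div, norm_pow, Real.norm_of_nonneg (hG m).le]
    have := hG m
    gcongr
  have hp : 0 < ∑' m : ℕ, (0 : ℝ) ^ m / Real.Gamma (β * m + β) := by
    rw [tsum_eq_single 0 (fun m hm => by simp [hm])]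
    have := hG 0
    simpa using this
  obtain ⟨ε, hε, h⟩ := Metric.eventually_nhds_iff.1 (T.eventually (lt_mem_nhds hp))
  refine ⟨ε, hε, fun r hr hr' => h ?_⟩
  rwa [Real.dist_eq, sub_zero, abs_of_pos hr]

open MeasureTheory Set in
/-- for `0 < β < 1`, `a < 0`, `δ < 0` and every `t > 0`, the value
`S(t)` of the bivariate Mittag-Leffler type function with parameters
`(β,1,β; 0,1; β,1,β+1; β,β; 1,1)` at `(a t^β, δ t)` is strictly positive. -/
theorem bivMLS_pos (β a δ : ℝ) (hβ₀ : 0 < β) (hβ₁ : β < 1) (ha : a < 0)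
    (hδ : δ < 0) (t : ℝ) (ht : 0 < t) : 0 < bivMLS β a δ t := by
  obtain ⟨x, hx, hxe⟩ : ∃ x : ℝ, 0 < x ∧ a * t ^ β = -x :=
    ⟨-(a * t ^ β), by have := Real.rpow_pos_of_pos ht β; nlinarith, by ring⟩
  obtain ⟨y, hye⟩ : ∃ y : ℝ, δ * t = y := ⟨_, rfl⟩
  have hG : ∀ m : ℕ, 0 < Real.Gamma (β * m + β) := fun m => Real.Gamma_pos_of_pos (by positivity)
  have hs : ∀ p : ℕ × ℕ, 0 < β * (p.1 : ℝ) + p.2 + β := fun p => by positivity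
  set c : ℕ × ℕ → ℝ := fun p => ((-x) ^ p.1 / Real.Gamma (β * p.1 + β)) *
    (y ^ p.2 / (Nat.factorial p.2)) with hc
  set F : ℕ × ℕ → ℝ → ℝ := fun p r => r ^ (β * (p.1 : ℝ) + p.2 + β - 1) * c p with hF
  set μ := (volume : Measure ℝ).restrict (Ioc 0 1) with hμ
  -- integrals of powers
  have hint : ∀ p : ℕ × ℕ, Integrable (fun r : ℝ => r ^ (β * (p.1 : ℝ) + p.2 + β - 1)) μ := by
    intro p
    have := intervalIntegral.intervalIntegrable_rpow' (a := 0) (b := 1)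
      (r := β * (p.1 : ℝ) + p.2 + β - 1) (by linarith [hs p])
    exact (intervalIntegrable_iff_integrableOn_Ioc_of_le zero_le_one).1 this
  have hval : ∀ p : ℕ × ℕ, ∫ r, r ^ (β * (p.1 : ℝ) + p.2 + β - 1) ∂μ =
      1 / (β * (p.1 : ℝ) + p.2 + β) := by
    intro p
    have := integral_rpow (a := 0) (b := 1)
      (r := β * (p.1 : ℝ) + p.2 + β - 1) (Or.inl (by linarith [hs p]))
    rw [intervalIntegral.integral_of_le zero_le_one] at this
    rw [hμ, this, sub_add_cancel, Real.one_rpow, Real.zero_rpow (hs p).ne', sub_zero]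
  have hFi : ∀ p, Integrable (F p) μ := fun p => (hint p).mul_const _
  have hFv : ∀ p, ∫ r, F p r ∂μ = 1 / (β * (p.1 : ℝ) + p.2 + β) * c p := by
    intro p
    rw [hF, integral_mul_const, hval]
  have hFn : ∀ p, ∫ r, ‖F p r‖ ∂μ = 1 / (β * (p.1 : ℝ) + p.2 + β) * ‖c p‖ := by
    intro p
    rw [← hval p, ← integral_mul_const]
    refine setIntegral_congr_fun measurableSet_Ioc fun r hr => ?_
    simp only [hF]
    rw [norm_mul, Real.norm_of_nonneg (Real.rpow_nonneg hr.1.le _)]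
  have sML : ∀ z : ℝ, Summable fun m : ℕ => ‖(-z) ^ m / Real.Gamma (β * m + β)‖ := by
    intro z
    refine Summable.of_nonneg_of_le (fun _ => norm_nonneg _) (fun m => ?_)
      (bml_summable_pos β (|z| + 1) hβ₀ hβ₁ (by positivity))
    have := hG m
    rw [norm_div, norm_pow, norm_neg, Real.norm_of_nonneg this.le, Real.norm_eq_abs]
    gcongr
    linarith
  have sE : ∀ z : ℝ, Summable fun k : ℕ => ‖z ^ k / (Nat.factorial k : ℝ)‖ := fun z =>
    (Real.summable_pow_div_factorial z).norm
  have sc : Summable fun p => ‖c p‖ := (summable_mul_of_summable_norm (sML x) (sE y)).norm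
  have sF : Summable fun p => ∫ r, ‖F p r‖ ∂μ := by
    refine Summable.of_nonneg_of_le (fun p => integral_nonneg fun _ => norm_nonneg _) (fun p => ?_)
      (sc.mul_left (1 / β))
    rw [hFn]
    have : β ≤ β * (p.1 : ℝ) + p.2 + β := by
      have : 0 ≤ β * (p.1 : ℝ) + p.2 := by positivity
      linarith
    gcongr
  have HS := hasSum_integral_of_summable_integral_norm hFi sF
  -- rewrite the series
  have hSeq : bivMLS β a δ t = 1 / Real.Gamma β * ∫ r, (∑' p, F p r) ∂μ := by
    rw [← HS.tsum_eq, ← tsum_mul_left, bivMLS]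
    refine tsum_congr fun p => ?_
    rw [hFv, hxe, hye, Real.Gamma_add_one (hs p).ne', hc]
    have h1 := (Real.Gamma_pos_of_pos (hs p)).ne'
    have h2 := (Real.Gamma_pos_of_pos hβ₀).ne'
    have h3 := (hs p).ne'
    have h4 := (hG p.1).ne'
    beta_reduce
    field_simp
  have hpt : ∀ r : ℝ, 0 < r → ∑' p, F p r = r ^ (β - 1) *
      ((∑' m : ℕ, (-(x * r ^ β)) ^ m / Real.Gamma (β * m + β)) * Real.exp (y * r)) := by
    intro r hr
    rw [Real.exp_eq_exp_ℝ, NormedSpace.exp_eq_tsum_div]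
    beta_reduce
    rw [tsum_mul_tsum_of_summable_norm (sML _) (sE _), ← tsum_mul_left]
    refine tsum_congr fun p => ?_
    have e : r ^ (β * (p.1 : ℝ) + p.2 + β - 1) = r ^ (β - 1) * ((r ^ β) ^ p.1 * r ^ p.2) := by
      rw [show β * (p.1 : ℝ) + p.2 + β - 1 = (β - 1) + (β * p.1 + p.2) by ring,
        Real.rpow_add hr, Real.rpow_add hr, Real.rpow_mul hr.le, Real.rpow_natCast,
        Real.rpow_natCast]
    simp only [hF, hc]
    rw [e, ← neg_mul, mul_pow, mul_pow]
    ring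
  have hnn : 0 ≤ᵐ[μ] fun r => ∑' p, F p r := by
    refine (ae_restrict_iff' measurableSet_Ioc).2 (Filter.Eventually.of_forall fun r hr => ?_)
    have hr0 : 0 < r := hr.1
    change 0 ≤ ∑' p, F p r
    rw [hpt r hr0]
    have := bml_nonneg β (x * r ^ β) hβ₀ hβ₁ (by positivity)
    positivity
  have hI : Integrable (fun r => ∑' p, F p r) μ := by
    have hmeas : AEStronglyMeasurable (fun r => ∑' p, F p r) μ := by
      refine Measurable.aestronglyMeasurable ?_
      refine Measurable.tsum fun p => ?_
      simp only [hF]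
      fun_prop
    have hi0 := (hint (0, 0)).mul_const (∑' p, ‖c p‖)
    refine hi0.mono' hmeas ?_
    refine (ae_restrict_iff' measurableSet_Ioc).2 (Filter.Eventually.of_forall fun r hr => ?_)
    have hr0 : 0 < r := hr.1
    refine tsum_of_norm_bounded (sc.hasSum.mul_left _) fun p => ?_
    simp only [hF]
    rw [norm_mul, Real.norm_of_nonneg (Real.rpow_nonneg hr0.le _)]
    refine mul_le_mul_of_nonneg_right ?_ (norm_nonneg _)
    refine Real.rpow_le_rpow_of_exponent_ge hr0 hr.2 ?_
    have : 0 ≤ β * (p.1 : ℝ) + p.2 := by positivity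
    simp only [Nat.cast_zero]
    linarith
  rw [hSeq]
  have hΓ := Real.Gamma_pos_of_pos hβ₀
  refine mul_pos (by positivity) ?_
  rw [integral_pos_iff_support_of_nonneg_ae hnn hI]
  obtain ⟨ε, hε, h⟩ := bml_near_zero β x hβ₀ hβ₁ hx
  have hsub : Ioo 0 (min ε 1) ⊆ Function.support (fun r => ∑' p, F p r) := by
    intro r hr
    have hr1 : 0 < r := hr.1
    rw [Function.mem_support, hpt r hr1]
    have := h r hr1 (hr.2.trans_le (min_le_left _ _))
    positivity
  refine lt_of_lt_of_le ?_ (measure_mono hsub)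
  rw [hμ, Measure.restrict_apply measurableSet_Ioo, inter_eq_left.2]
  · simp [hε]
  · intro r hr
    exact ⟨hr.1, (hr.2.trans_le (min_le_right _ _)).le⟩
end

section
/- Let 0 < β < 1, a < 0, δ < 0, q > 0, and let M : [0,q] → ℝ be continuous with M(t) ≥ 0 for all t ∈ [0,q] and ∫₀^q M(t) dt > 0. Define S(t) = ∑_{m=0}^∞ ∑_{k=0}^∞ [Γ(βm+k+β) / (Γ(β) Γ(βm+k+β+1))] · (a t^β)^m/Γ(βm+β) · (δ t)^k/k! and A = ∫₀^q M(t) (1 − a Γ(β) t^β S(t)) dt. Then A > ∫₀^q M(t) dt > 0; in particular A ≠ 0. -/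
open MeasureTheory Set

lemma aux_gamma_lower (s R : ℝ) (hs : 0 < s) (hR : 0 < R) :
    Real.exp (-(R+1)) * (R ^ s / (R+1)) ≤ Real.Gamma s := by
  rw [Real.Gamma_eq_integral hs]
  have hint := Real.GammaIntegral_convergent hs
  have hsub : Ioc R (R+1) ⊆ Ioi (0:ℝ) := fun x hx => hR.trans hx.1
  have h1 : ∫ x in Ioc R (R+1), Real.exp (-x) * x ^ (s-1) ≤
      ∫ x in Ioi (0:ℝ), Real.exp (-x) * x ^ (s-1) := by
    apply setIntegral_mono_set hint
    · filter_upwards [ae_restrict_mem measurableSet_Ioi] with x hx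
      have : (0:ℝ) < x := hx
      simp only [Pi.zero_apply]; positivity
    · exact hsub.eventuallyLE
  have h2 : ∫ x in Ioc R (R+1), Real.exp (-(R+1)) * (R ^ s / (R+1)) ≤
      ∫ x in Ioc R (R+1), Real.exp (-x) * x ^ (s-1) := by
    apply setIntegral_mono_on
    · exact integrableOn_const (by simp)
    · exact hint.mono_set hsub
    · exact measurableSet_Ioc
    · intro x hx
      have hx0 : 0 < x := hR.trans hx.1
      have e1 : Real.exp (-(R+1)) ≤ Real.exp (-x) := Real.exp_le_exp.2 (by linarith [hx.2])
      have e2 : R ^ s / (R+1) ≤ x ^ (s-1) := by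
        rw [Real.rpow_sub_one hx0.ne']
        have : R ^ s ≤ x ^ s := Real.rpow_le_rpow hR.le hx.1.le hs.le
        exact div_le_div₀ (by positivity) this hx0 hx.2
      exact mul_le_mul e1 e2 (by positivity) (by positivity)
  simp at h2
  refine le_trans ?_ (h2.trans h1)
  simp

lemma aux_summable (β x : ℝ) (hβ : 0 < β) :
    Summable (fun m : ℕ => |x| ^ m / Real.Gamma (β * m + β)) := by
  obtain ⟨R, hR, hRβ⟩ : ∃ R : ℝ, 0 < R ∧ R ^ β = 2 * (|x| + 1) := by
    refine ⟨(2 * (|x| + 1)) ^ (1/β), by positivity, ?_⟩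
    rw [← Real.rpow_mul (by positivity), one_div, inv_mul_cancel₀ hβ.ne', Real.rpow_one]
  set C := Real.exp (-(R+1)) * (R ^ β / (R+1)) with hC
  have hCpos : 0 < C := by positivity
  have hg : Summable (fun m : ℕ => (1/2:ℝ)^m * C⁻¹) :=
    (summable_geometric_of_lt_one (by norm_num) (by norm_num)).mul_right _
  refine Summable.of_nonneg_of_le (fun m => ?_) (fun m => ?_) hg
  · have : 0 < Real.Gamma (β * m + β) := Real.Gamma_pos_of_pos (by positivity)
    positivity
  · have h := aux_gamma_lower (β * m + β) R (by positivity) hR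
    have h3 : Real.exp (-(R+1)) * (R ^ (β * m + β) / (R+1)) = (2 * (|x| + 1)) ^ m * C := by
      rw [Real.rpow_add hR, Real.rpow_mul hR.le, hRβ, Real.rpow_natCast, hC, ← hRβ]; ring
    rw [h3] at h
    calc |x| ^ m / Real.Gamma (β * m + β) ≤ (|x|+1) ^ m / ((2 * (|x| + 1)) ^ m * C) := by
          apply div_le_div₀ (by positivity) _ (by positivity) h
          exact pow_le_pow_left₀ (abs_nonneg _) (by linarith) m
      _ = (1/2:ℝ)^m * C⁻¹ := by
          have h2 : (1/2:ℝ)^m = ((2:ℝ)^m)⁻¹ := by rw [one_div, inv_pow]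
          rw [mul_pow, h2]; field_simp

noncomputable def auxg (β x : ℝ) : ℝ := ∑' m : ℕ, x ^ m / Real.Gamma (β * m + β)

lemma auxg_term_le (β x R : ℝ) (hβ : 0 < β) (hx : |x| ≤ R) (m : ℕ) :
    ‖x ^ m / Real.Gamma (β * m + β)‖ ≤ |R| ^ m / Real.Gamma (β * m + β) := by
  have : 0 < Real.Gamma (β * m + β) := Real.Gamma_pos_of_pos (by positivity)
  rw [norm_div, norm_pow, Real.norm_eq_abs, Real.norm_of_nonneg this.le]
  exact div_le_div_of_nonneg_right
    (pow_le_pow_left₀ (abs_nonneg _) (hx.trans (le_abs_self _)) m) this.le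

lemma auxg_cont (β : ℝ) (hβ : 0 < β) : Continuous (auxg β) := by
  rw [continuous_iff_continuousAt]
  intro x
  have : ContinuousOn (auxg β) (Metric.ball 0 (|x|+1)) := by
    apply continuousOn_tsum (u := fun m : ℕ => |(|x|+1)| ^ m / Real.Gamma (β * m + β))
    · intro m; fun_prop
    · exact aux_summable β _ hβ
    · intro m y hy
      apply auxg_term_le _ _ _ hβ
      simpa using (mem_ball_zero_iff.1 hy).le
  exact this.continuousAt (Metric.isOpen_ball.mem_nhds (by simp))

lemma auxg_hasSum (β x : ℝ) (hβ : 0 < β) :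
    HasSum (fun m : ℕ => x ^ m / Real.Gamma (β * m + β)) (auxg β x) := by
  apply Summable.hasSum
  exact Summable.of_norm_bounded (aux_summable β (|x|) hβ) (auxg_term_le β x |x| hβ le_rfl)

noncomputable def auxf (β a s : ℝ) : ℝ := auxg β (a * s ^ β)

lemma auxf_cont (β a : ℝ) (hβ : 0 < β) : Continuous (auxf β a) :=
  (auxg_cont β hβ).comp (continuous_const.mul (Real.continuous_rpow_const hβ.le))

lemma aux_swap {ι : Type} [Countable ι] (t : ℝ) (ht : 0 < t) (W : ℝ → ℝ)
    (hW : IntervalIntegrable W volume 0 t) (c : ι → ℝ → ℝ) (b : ι → ℝ) (f : ℝ → ℝ)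
    (hc : ∀ i, Continuous (c i)) (hb : Summable b)
    (hcb : ∀ i, ∀ s ∈ Ioc 0 t, ‖c i s‖ ≤ b i)
    (hf : ∀ s ∈ Ioc 0 t, HasSum (fun i => c i s) (f s)) :
    HasSum (fun i => ∫ s in (0:ℝ)..t, W s * c i s) (∫ s in (0:ℝ)..t, W s * f s) := by
  apply intervalIntegral.hasSum_integral_of_dominated_convergence (fun i s => ‖W s‖ * b i)
  · intro i
    exact (hW.def'.aestronglyMeasurable).mul (hc i).aestronglyMeasurable
  · intro i
    refine ae_of_all _ fun s hs => ?_
    rw [uIoc_of_le ht.le] at hs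
    rw [norm_mul]
    exact mul_le_mul_of_nonneg_left (hcb i s hs) (norm_nonneg _)
  · exact ae_of_all _ fun s _ => hb.mul_left _
  · simp_rw [tsum_mul_left]
    exact hW.norm.mul_const _
  · refine ae_of_all _ fun s hs => ?_
    rw [uIoc_of_le ht.le] at hs
    exact (hf s hs).mul_left _

lemma aux_beta (u v t : ℝ) (hu : 0 < u) (hv : 0 < v) (ht : 0 < t) :
    ∫ s in (0:ℝ)..t, s ^ (u-1) * (t-s) ^ (v-1) =
      t ^ (u+v-1) * (Real.Gamma u * Real.Gamma v / Real.Gamma (u+v)) := by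
  have h := Complex.betaIntegral_scaled (u:ℂ) (v:ℂ) ht
  rw [Complex.betaIntegral_eq_Gamma_mul_div _ _ (by simpa) (by simpa)] at h
  have e : ∫ x in (0:ℝ)..t, (x:ℂ) ^ ((u:ℂ)-1) * ((t:ℂ)-x) ^ ((v:ℂ)-1) =
      ((∫ s in (0:ℝ)..t, s ^ (u-1) * (t-s) ^ (v-1) : ℝ) : ℂ) := by
    rw [← intervalIntegral.integral_ofReal]
    apply intervalIntegral.integral_congr
    intro x hx
    rw [uIcc_of_le ht.le] at hx
    simp only
    push_cast
    rw [Complex.ofReal_cpow hx.1, Complex.ofReal_cpow (by linarith [hx.2] : 0 ≤ t - x)]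
    push_cast; rfl
  rw [e] at h
  have e2 : (t:ℂ) ^ ((u:ℂ)+v-1) * (Complex.Gamma u * Complex.Gamma v / Complex.Gamma (u+v)) =
    ((t ^ (u+v-1) * (Real.Gamma u * Real.Gamma v / Real.Gamma (u+v)) : ℝ) : ℂ) := by
    push_cast
    rw [Complex.ofReal_cpow ht.le, ← Complex.Gamma_ofReal, ← Complex.Gamma_ofReal,
      ← Complex.Gamma_ofReal]
    push_cast; rfl
  rw [e2] at h
  exact_mod_cast h

lemma aux_beta_int (u v t : ℝ) (hu : 0 < u) (hv : 0 < v) (ht : 0 < t) :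
    IntervalIntegrable (fun s => s ^ (u-1) * (t-s) ^ (v-1)) volume 0 t := by
  apply intervalIntegral.intervalIntegrable_of_integral_ne_zero
  rw [aux_beta u v t hu hv ht]
  have := Real.Gamma_pos_of_pos hu
  have := Real.Gamma_pos_of_pos hv
  have := Real.Gamma_pos_of_pos (add_pos hu hv)
  positivity

lemma aux_bd (β a s t : ℝ) (hβ : 0 < β) (hs : s ∈ Ioc 0 t) :
    |a * s ^ β| ≤ |a| * t ^ β := by
  rw [abs_mul, abs_of_nonneg (Real.rpow_nonneg hs.1.le _)]
  exact mul_le_mul_of_nonneg_left (Real.rpow_le_rpow hs.1.le hs.2 hβ.le) (abs_nonneg _)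

lemma aux_volterra (β a t : ℝ) (hβ : 0 < β) (ht : 0 < t) :
    a * ∫ s in (0:ℝ)..t, (s ^ (β-1) * (t-s) ^ (β-1)) * auxf β a s =
      t ^ (β-1) * (Real.Gamma β * auxf β a t - 1) := by
  have h := aux_swap t ht _ (aux_beta_int β β t hβ hβ ht)
    (fun (m:ℕ) s => (a * s ^ β) ^ m / Real.Gamma (β * m + β))
    (fun (m:ℕ) => |(|a| * t ^ β)| ^ m / Real.Gamma (β * m + β)) (auxf β a)
    (fun m => by
      have := Real.continuous_rpow_const hβ.le
      fun_prop) (aux_summable β _ hβ)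
    (fun m s hs => auxg_term_le _ _ _ hβ (aux_bd β a s t hβ hs) m)
    (fun s hs => auxg_hasSum _ _ hβ)
  have hΓ := Real.Gamma_pos_of_pos hβ
  have hterm : ∀ m : ℕ, a * ∫ s in (0:ℝ)..t, (s ^ (β-1) * (t-s) ^ (β-1)) *
      ((a * s ^ β) ^ m / Real.Gamma (β * m + β)) =
      t ^ (β-1) * Real.Gamma β * ((a * t ^ β) ^ (m+1) / Real.Gamma (β * (m+1:ℕ) + β)) := by
    intro m
    have hG : 0 < Real.Gamma (β * m + β) := Real.Gamma_pos_of_pos (by positivity)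
    have : ∫ s in (0:ℝ)..t, (s ^ (β-1) * (t-s) ^ (β-1)) *
      ((a * s ^ β) ^ m / Real.Gamma (β * m + β)) =
      ∫ s in (0:ℝ)..t, (a ^ m / Real.Gamma (β * m + β)) *
        (s ^ ((β * m + β)-1) * (t-s) ^ (β-1)) := by
      apply intervalIntegral.integral_congr_ae
      refine ae_of_all _ fun s hs => ?_
      rw [uIoc_of_le ht.le] at hs
      rw [show β * m + β - 1 = β * m + (β - 1) by ring, Real.rpow_add hs.1,
        Real.rpow_mul hs.1.le, Real.rpow_natCast]
      ring
    rw [this, intervalIntegral.integral_const_mul, aux_beta _ _ _ (by positivity) hβ ht]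
    rw [show β * m + β + β - 1 = β * (m+1:ℕ) + (β - 1) by push_cast; ring, Real.rpow_add ht,
        Real.rpow_mul ht.le, Real.rpow_natCast,
        show β * m + β + β = β * (m+1:ℕ) + β by push_cast; ring]
    field_simp
    ring
  have h1 := h.mul_left a
  simp_rw [hterm] at h1
  have h2 := (auxg_hasSum β (a * t ^ β) hβ)
  rw [← hasSum_nat_add_iff' 1] at h2
  have h3 := h2.mul_left (t ^ (β-1) * Real.Gamma β)
  rw [h1.unique h3]
  simp [auxf]
  field_simp

lemma auxf_zero (β a : ℝ) (hβ : 0 < β) : 0 < auxf β a 0 := by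
  have : auxf β a 0 = 1 / Real.Gamma β := by
    rw [auxf, auxg, Real.zero_rpow hβ.ne', tsum_eq_single 0]
    · simp
    · intro m hm; simp [hm]
  rw [this]
  have := Real.Gamma_pos_of_pos hβ
  positivity

lemma auxf_pos (β a : ℝ) (hβ : 0 < β) (hβ1 : β < 1) (ha : a < 0) (t : ℝ) (ht : 0 ≤ t) :
    0 < auxf β a t := by
  by_contra hneg
  push Not at hneg
  have hΓ := Real.Gamma_pos_of_pos hβ
  have hcont := auxf_cont β a hβ
  set Z : Set ℝ := {s | 0 ≤ s ∧ auxf β a s ≤ 0} with hZ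
  have hZc : IsClosed Z := (isClosed_le continuous_const continuous_id).inter
    (isClosed_le hcont continuous_const)
  have hZb : BddBelow Z := ⟨0, fun s hs => hs.1⟩
  obtain ⟨t0, ht0Z, hmin⟩ : ∃ t0 ∈ Z, ∀ s ∈ Z, t0 ≤ s :=
    ⟨sInf Z, hZc.csInf_mem ⟨t, ht, hneg⟩ hZb, fun s hs => csInf_le hZb hs⟩
  have ht0 : 0 < t0 := by
    rcases ht0Z.1.lt_or_eq with h | h
    · exact h
    · have := ht0Z.2
      rw [← h] at this
      linarith [auxf_zero β a hβ]
  have hfpos : ∀ s, 0 ≤ s → s < t0 → 0 < auxf β a s := by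
    intro s hs hs2
    by_contra hc
    push Not at hc
    linarith [hmin s ⟨hs, hc⟩]
  obtain ⟨η, hη, hη2, hηb⟩ : ∃ η : ℝ, 0 < η ∧ η < t0/2 ∧
      -a * (η ^ β / β) < Real.Gamma β * (1/2) := by
    have hc : Filter.Tendsto (fun η : ℝ => -a * (η ^ β / β)) (nhds 0) (nhds (-a * ((0:ℝ)^β / β))) := by
      have : Continuous (fun η : ℝ => -a * (η ^ β / β)) := by
        have := Real.continuous_rpow_const hβ.le
        fun_prop
      exact this.tendsto 0
    rw [Real.zero_rpow hβ.ne'] at hc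
    have h1 := (hc.eventually (gt_mem_nhds (show -a * (0/β) < Real.Gamma β * (1/2) by
      simp; positivity)))
    have h2 := (h1.and (gt_mem_nhds (show (0:ℝ) < t0/2 by positivity))).filter_mono
      (nhdsWithin_le_nhds (s := Ioi 0))
    obtain ⟨η, h, hpos⟩ := (h2.and self_mem_nhdsWithin).exists
    exact ⟨η, hpos, h.2, h.1⟩
  set v : ℝ → ℝ := fun s => s ^ (β-1) * auxf β a s with hv
  have hvc : ContinuousOn v (Icc (t0-η) t0) := by
    apply ContinuousOn.mul _ hcont.continuousOn
    apply ContinuousOn.rpow_const continuousOn_id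
    intro x hx
    left
    have := hx.1
    simp only [id]; linarith
  obtain ⟨t1, ht1, hmax⟩ := isCompact_Icc.exists_isMaxOn
    (nonempty_Icc.2 (by linarith : t0 - η ≤ t0)) hvc
  have hmax' : ∀ s ∈ Icc (t0-η) t0, v s ≤ v t1 := fun s hs => hmax hs
  have hv0 : v t0 ≤ 0 := mul_nonpos_of_nonneg_of_nonpos (by positivity) ht0Z.2
  have hv1 : 0 < v t1 := by
    refine lt_of_lt_of_le ?_ (hmax' (t0-η) ⟨le_rfl, by linarith⟩)
    exact mul_pos (Real.rpow_pos_of_pos (by linarith) _) (hfpos _ (by linarith) (by linarith))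
  have ht10 : t1 < t0 := by
    rcases ht1.2.lt_or_eq with h | h
    · exact h
    · rw [h] at hv1; linarith
  have ht1p : 0 < t1 := by linarith [ht1.1]
  have V0 := aux_volterra β a t0 hβ ht0
  have V1 := aux_volterra β a t1 hβ ht1p
  have int0 := (aux_beta_int β β t0 hβ hβ ht0).mul_continuousOn (hcont.continuousOn)
  have int1 := (aux_beta_int β β t1 hβ hβ ht1p).mul_continuousOn (hcont.continuousOn)
  have intJ : IntervalIntegrable (fun s => s ^ (β-1) * (t0-s) ^ (β-1) * auxf β a s) volume 0 t1 :=
    int0.mono_set (by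
      rw [uIcc_of_le ht1p.le, uIcc_of_le ht0.le]; exact Icc_subset_Icc le_rfl ht10.le)
  have intK : IntervalIntegrable (fun s => s ^ (β-1) * (t0-s) ^ (β-1) * auxf β a s) volume t1 t0 :=
    int0.mono_set (by
      rw [uIcc_of_le ht10.le, uIcc_of_le ht0.le]; exact Icc_subset_Icc ht1p.le le_rfl)
  have hsplit := intervalIntegral.integral_add_adjacent_intervals intJ intK
  set c : ℝ := (t0/t1) ^ (β-1) with hc
  have hcpos : 0 < c := by positivity
  have hc1 : c * t1 ^ (β-1) = t0 ^ (β-1) := by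
    rw [hc, ← Real.mul_rpow (by positivity) ht1p.le, div_mul_cancel₀ _ ht1p.ne']
  have hchalf : 1/2 ≤ c := by
    have h1 : (1:ℝ) ≤ t0/t1 := by rw [le_div_iff₀ ht1p]; linarith
    have h2 : t0/t1 ≤ 2 := by rw [div_le_iff₀ ht1p]; linarith [ht1.1]
    calc (1/2:ℝ) ≤ (t0/t1)⁻¹ := by
          rw [one_div]; exact inv_anti₀ (by positivity) h2
      _ = (t0/t1) ^ (-1:ℝ) := by rw [Real.rpow_neg_one]
      _ ≤ c := Real.rpow_le_rpow_of_exponent_le h1 (by linarith)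
  have hJ : ∫ s in (0:ℝ)..t1, s ^ (β-1) * (t0-s) ^ (β-1) * auxf β a s ≤
      c * ∫ s in (0:ℝ)..t1, s ^ (β-1) * (t1-s) ^ (β-1) * auxf β a s := by
    rw [← intervalIntegral.integral_const_mul]
    apply intervalIntegral.integral_mono_on_of_le_Ioo ht1p.le intJ (int1.const_mul c)
    intro s hs
    have hs1 : 0 < t1 - s := by linarith [hs.2]
    have hle : (t0-s) ^ (β-1) ≤ c * (t1-s) ^ (β-1) := by
      rw [hc, ← Real.mul_rpow (by positivity) hs1.le]
      apply Real.rpow_le_rpow_of_nonpos (by positivity) _ (by linarith)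
      rw [div_mul_eq_mul_div, div_le_iff₀ ht1p]
      nlinarith [hs.1]
    have hf := (hfpos s hs.1.le (by linarith [hs.2])).le
    have hs0 : 0 ≤ s ^ (β-1) := Real.rpow_nonneg hs.1.le _
    calc s ^ (β-1) * (t0-s) ^ (β-1) * auxf β a s
        ≤ s ^ (β-1) * (c * (t1-s) ^ (β-1)) * auxf β a s := by gcongr
      _ = _ := by ring
  have intP : IntervalIntegrable (fun s => (t0 - s) ^ (β-1)) volume t1 t0 := by
    have := (intervalIntegral.intervalIntegrable_rpow' (a := t0-t1) (b := 0)
      (show -1 < β - 1 by linarith)).comp_sub_left t0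
    simpa using this
  have hP : ∫ s in t1..t0, (t0 - s) ^ (β-1) = (t0-t1) ^ β / β := by
    rw [intervalIntegral.integral_comp_sub_left (fun x => x ^ (β-1)) t0,
      integral_rpow (Or.inl (by linarith))]
    simp [Real.zero_rpow hβ.ne']
  have hK : ∫ s in t1..t0, s ^ (β-1) * (t0-s) ^ (β-1) * auxf β a s ≤
      v t1 * (η ^ β / β) := by
    calc _ ≤ ∫ s in t1..t0, v t1 * (t0 - s) ^ (β-1) := by
          apply intervalIntegral.integral_mono_on_of_le_Ioo ht10.le intK (intP.const_mul _)
          intro s hs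
          have h1 := hmax' s ⟨by linarith [ht1.1, hs.1], hs.2.le⟩
          have h2 : 0 ≤ (t0-s) ^ (β-1) := Real.rpow_nonneg (by linarith [hs.2]) _
          calc _ = v s * (t0-s) ^ (β-1) := by simp only [hv]; ring
            _ ≤ _ := by gcongr
      _ = v t1 * ((t0-t1) ^ β / β) := by rw [intervalIntegral.integral_const_mul, hP]
      _ ≤ _ := by
          gcongr
          linarith [ht1.1]
  set I0 := ∫ s in (0:ℝ)..t0, s ^ (β-1) * (t0-s) ^ (β-1) * auxf β a s
  set I1 := ∫ s in (0:ℝ)..t1, s ^ (β-1) * (t1-s) ^ (β-1) * auxf β a s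
  have V0' : t0 ^ (β-1) ≤ -a * I0 := by
    have : a * I0 = Real.Gamma β * v t0 - t0 ^ (β-1) := by rw [V0]; simp only [hv]; ring
    nlinarith
  have V1' : -a * (c * I1) = t0 ^ (β-1) - c * Real.Gamma β * v t1 := by
    have : a * I1 = Real.Gamma β * v t1 - t1 ^ (β-1) := by rw [V1]; simp only [hv]; ring
    rw [← hc1]
    linear_combination (-c) * this
  have hfin : -a * I0 ≤ -a * (c * I1) + -a * (v t1 * (η ^ β / β)) := by
    rw [← mul_add, ← hsplit]
    exact mul_le_mul_of_nonneg_left (add_le_add hJ hK) (by linarith)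
  have hlast : v t1 * (-a * (η ^ β / β)) < v t1 * (c * Real.Gamma β) := by
    apply mul_lt_mul_of_pos_left _ hv1
    nlinarith
  nlinarith

lemma aux_w_int (β a δ t : ℝ) (hβ : 0 < β) :
    IntervalIntegrable (fun s => s ^ (β-1) * (auxf β a s * Real.exp (δ * s))) volume 0 t := by
  apply (intervalIntegral.intervalIntegrable_rpow' (by linarith)).mul_continuousOn
  have := auxf_cont β a hβ
  exact Continuous.continuousOn (by fun_prop)

set_option maxHeartbeats 2000000 in
lemma aux_S (β a δ t : ℝ) (hβ : 0 < β) (ht : 0 < t) :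
    Real.Gamma β * t ^ β * bivMLS β a δ t =
      ∫ s in (0:ℝ)..t, s ^ (β-1) * (auxf β a s * Real.exp (δ * s)) := by
  have hΓ := Real.Gamma_pos_of_pos hβ
  have hexp : ∀ x : ℝ, HasSum (fun k : ℕ => x ^ k / (Nat.factorial k : ℝ)) (Real.exp x) := by
    intro x
    rw [Real.exp_eq_exp_ℝ]
    exact NormedSpace.expSeries_div_hasSum_exp x
  have hsum : Summable (fun mk : ℕ × ℕ => |(|a| * t ^ β)| ^ mk.1 / Real.Gamma (β * mk.1 + β) *
      ((|δ| * t) ^ mk.2 / (Nat.factorial mk.2 : ℝ))) := by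
    apply Summable.mul_of_nonneg (aux_summable β _ hβ) (hexp _).summable
    · intro m
      have : 0 < Real.Gamma (β * m + β) := Real.Gamma_pos_of_pos (by positivity)
      simp only [Pi.zero_apply]; positivity
    · intro k
      simp only [Pi.zero_apply]; positivity
  have h := aux_swap t ht (fun s => s ^ (β-1))
    (intervalIntegral.intervalIntegrable_rpow' (by linarith))
    (fun (mk:ℕ × ℕ) s => (a * s ^ β) ^ mk.1 / Real.Gamma (β * mk.1 + β) *
      ((δ * s) ^ mk.2 / (Nat.factorial mk.2 : ℝ)))
    _ (fun s => auxf β a s * Real.exp (δ * s))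
    (fun m => by
      have := Real.continuous_rpow_const hβ.le
      fun_prop) hsum
    (fun mk s hs => by
      rw [norm_mul]
      refine mul_le_mul (auxg_term_le _ _ _ hβ (aux_bd β a s t hβ hs) mk.1) ?_
        (norm_nonneg _) ?_
      · rw [norm_div, norm_pow, norm_mul, Real.norm_of_nonneg hs.1.le, Real.norm_eq_abs,
          Real.norm_of_nonneg (by positivity : (0:ℝ) ≤ (Nat.factorial mk.2 : ℝ))]
        have := hs.2
        have := hs.1
        gcongr
      · have : 0 < Real.Gamma (β * mk.1 + β) := Real.Gamma_pos_of_pos (by positivity)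
        positivity)
    (fun s hs => by
      have h1 := auxg_hasSum β (a * s ^ β) hβ
      have h2 := hexp (δ * s)
      exact h1.mul h2 (summable_mul_of_summable_norm h1.summable.norm h2.summable.norm))
  rw [← h.tsum_eq, bivMLS, ← tsum_mul_left]
  congr 1
  ext ⟨m, k⟩
  simp only
  have hG : 0 < Real.Gamma (β * m + β) := Real.Gamma_pos_of_pos (by positivity)
  have hz : 0 < β * m + k + β := by positivity
  have hG2 : 0 < Real.Gamma (β * m + k + β) := Real.Gamma_pos_of_pos hz
  have : ∫ s in (0:ℝ)..t, s ^ (β-1) *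
      ((a * s ^ β) ^ m / Real.Gamma (β * m + β) * ((δ * s) ^ k / (Nat.factorial k : ℝ))) =
      ∫ s in (0:ℝ)..t, (a ^ m / Real.Gamma (β * m + β) * (δ ^ k / (Nat.factorial k : ℝ))) *
        s ^ ((β * m + k + β) - 1) := by
    apply intervalIntegral.integral_congr_ae
    refine ae_of_all _ fun s hs => ?_
    rw [uIoc_of_le ht.le] at hs
    rw [show β * m + k + β - 1 = β * m + k + (β - 1) by ring, Real.rpow_add hs.1,
      Real.rpow_add hs.1, Real.rpow_mul hs.1.le, Real.rpow_natCast, Real.rpow_natCast]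
    ring
  rw [this, intervalIntegral.integral_const_mul, integral_rpow (Or.inl (by linarith)),
    Real.Gamma_add_one hz.ne', sub_add_cancel, Real.zero_rpow hz.ne', Real.rpow_add ht,
      Real.rpow_add ht, Real.rpow_mul ht.le, Real.rpow_natCast, Real.rpow_natCast]
  field_simp
  ring

/-- for `0 < β < 1`, `a < 0`, `δ < 0`, `q > 0` and a continuous
nonnegative `M` on `[0,q]` with `∫₀^q M > 0`, the coefficient
`A = ∫₀^q M(t) (1 − a Γ(β) t^β S(t)) dt` satisfies `A > ∫₀^q M(t) dt > 0`;
in particular `A ≠ 0`. -/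
theorem coefficient_A_pos (β a δ q : ℝ) (hβ₀ : 0 < β) (hβ₁ : β < 1)
    (ha : a < 0) (hδ : δ < 0) (hq : 0 < q) (M : ℝ → ℝ)
    (hMcont : ContinuousOn M (Set.Icc 0 q))
    (hMnonneg : ∀ t ∈ Set.Icc (0 : ℝ) q, 0 ≤ M t)
    (hMpos : 0 < ∫ t in (0 : ℝ)..q, M t) :
    (∫ t in (0 : ℝ)..q, M t) <
        (∫ t in (0 : ℝ)..q, M t * (1 - a * Real.Gamma β * t ^ β * bivMLS β a δ t)) ∧
      (0 : ℝ) < ∫ t in (0 : ℝ)..q, M t ∧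
      (∫ t in (0 : ℝ)..q, M t * (1 - a * Real.Gamma β * t ^ β * bivMLS β a δ t)) ≠ 0 := by
  have hfin : (∫ t in (0 : ℝ)..q, M t) <
        (∫ t in (0 : ℝ)..q, M t * (1 - a * Real.Gamma β * t ^ β * bivMLS β a δ t)) := by
    set H : ℝ → ℝ := fun t => ∫ s in (0:ℝ)..t, s ^ (β-1) * (auxf β a s * Real.exp (δ * s)) with hH
    have hHc : ContinuousOn H (Set.Icc 0 q) := by
      have := intervalIntegral.continuousOn_primitive_interval' (aux_w_int β a δ q hβ₀)
        Set.left_mem_uIcc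
      rwa [Set.uIcc_of_le hq.le] at this
    have hHS : ∀ t ∈ Set.Icc 0 q, Real.Gamma β * t ^ β * bivMLS β a δ t = H t := by
      intro t ht
      rcases ht.1.lt_or_eq with h | h
      · exact aux_S β a δ t hβ₀ h
      · subst h
        simp [hH, Real.zero_rpow hβ₀.ne']
    have hHpos : ∀ t, 0 < t → 0 < H t := by
      intro t ht
      apply intervalIntegral.intervalIntegral_pos_of_pos_on (aux_w_int β a δ t hβ₀) _ ht
      intro s hs
      have h1 := auxf_pos β a hβ₀ hβ₁ ha s hs.1.le
      have h2 := Real.rpow_pos_of_pos hs.1 (β-1)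
      positivity
    have heq : (∫ t in (0 : ℝ)..q, M t * (1 - a * Real.Gamma β * t ^ β * bivMLS β a δ t)) =
        ∫ t in (0 : ℝ)..q, M t * (1 - a * H t) := by
      apply intervalIntegral.integral_congr
      intro t ht
      rw [Set.uIcc_of_le hq.le] at ht
      simp only
      rw [← hHS t ht]
      ring
    rw [heq]
    have hgc : ContinuousOn (fun t => M t * (1 - a * H t)) (Set.Icc 0 q) :=
      hMcont.mul (continuousOn_const.sub (continuousOn_const.mul hHc))
    apply intervalIntegral.integral_lt_integral_of_continuousOn_of_le_of_exists_lt hq hMcont hgc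
    · intro t ht
      have h1 := hMnonneg t ⟨ht.1.le, ht.2⟩
      have h2 := mul_neg_of_neg_of_pos ha (hHpos t ht.1)
      nlinarith
    · by_contra hcon
      push Not at hcon
      have hz : ∀ t ∈ Set.Ioc 0 q, M t = 0 := by
        intro t ht
        have h1 := hMnonneg t ⟨ht.1.le, ht.2⟩
        have h2 := mul_neg_of_neg_of_pos ha (hHpos t ht.1)
        have h3 := hcon t ⟨ht.1.le, ht.2⟩
        nlinarith
      have : ∫ t in (0 : ℝ)..q, M t = 0 := by
        rw [intervalIntegral.integral_of_le hq.le,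
          MeasureTheory.setIntegral_congr_fun measurableSet_Ioc hz]
        simp
      linarith
  exact ⟨hfin, hMpos, (hMpos.trans hfin).ne'⟩
end

section
/- Let 0 < β < 1, a < 0, b < 0, δ < 0, q > 0, p > 0. Let ψ ∈ C[0,p], φ ∈ C[0,q], M ∈ C[0,q], and let f(t,x) = t^{−ε₁} x^{−ε₂} f̃(t,x) with f̃ continuous on [0,q]×[0,p], 0 ≤ ε₁ < β, 0 ≤ ε₂ < 1. Define g(x) = ψ(x) + e^{bx} ∫₀^q M(t)(φ(t) − φ(0)) dt − a φ(0) ∫₀^q M(t) t^β F₁(a t^β, b x, δ t) dt + a b x ∫₀^q φ(η) ∫_η^q M(t) (t−η)^{β−1} F₃(a(t−η)^β, b x, δ(t−η)) dt dη + ∫₀^q M(t) ∫₀^t ∫₀^x (t−η)^{β−1} f(η,ξ) F₄(a(t−η)^β, b(x−ξ), δ(t−η)) dξ dη dt, where F₁, F₃, F₄ are the trivariate Mittag-Leffler type functions with parameters (β,1,β; 1,1,2; β,1,β+1; β,β; 1,2; 1,1; 1,1; 1,1), (β,1,β; 1,1,2; β,1,β; β,β; 1,2; 1,1; 1,1; 1,2)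 and (β,1,β; 1,1,1; β,1,β; β,β; 1,1; 1,1; 1,1; 1,1) respectively (i.e. the parameter lists of the solution representation with α = 1 and γ = β). Then g is well defined and continuous on [0,p]; in particular there exists C₃ > 0 with |g(x)| ≤ C₃ for all x ∈ [0,p]. -/
/-- The trivariate Mittag-Leffler type function with parameters
`(α₁,β₁,δ₁; α₂,γ₁,δ₂; α₃,β₂,δ₃; α₄,δ₄; α₅,δ₅; β₃,δ₆; γ₂,δ₇; γ₃,δ₈)`. -/
noncomputable def trivML (α₁ β₁ δ₁ α₂ γ₁ δ₂ α₃ β₂ δ₃ α₄ δ₄ α₅ δ₅ β₃ δ₆ γ₂ δ₇ γ₃ δ₈ : ℝ)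
    (x y z : ℝ) : ℝ :=
  ∑' mjk : ℕ × ℕ × ℕ,
    Real.Gamma (α₁ * mjk.1 + β₁ * mjk.2.2 + δ₁) *
      Real.Gamma (α₂ * mjk.1 + γ₁ * mjk.2.1 + δ₂) *
      x ^ mjk.1 * y ^ mjk.2.1 * z ^ mjk.2.2 /
      (Real.Gamma (α₃ * mjk.1 + β₂ * mjk.2.2 + δ₃) * Real.Gamma (α₄ * mjk.1 + δ₄) *
        Real.Gamma (α₅ * mjk.1 + δ₅) * Real.Gamma (β₃ * mjk.2.2 + δ₆) *
        Real.Gamma (γ₂ * mjk.2.1 + δ₇) * Real.Gamma (γ₃ * mjk.2.1 + δ₈))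

/-- The right-hand side `g` of the Volterra integral equation (with `α = 1`,
`γ = β`), built from the data `ψ, φ, M, f`:
`g(x) = ψ(x) + e^{bx} ∫₀^q M(t)(φ(t) − φ(0)) dt
  − a φ(0) ∫₀^q M(t) t^β F₁(a t^β, bx, δ t) dt
  + a b x ∫₀^q φ(η) ∫_η^q M(t) (t−η)^{β−1} F₃(a(t−η)^β, bx, δ(t−η)) dt dη
  + ∫₀^q M(t) ∫₀^t ∫₀^x (t−η)^{β−1} f(η,ξ) F₄(a(t−η)^β, b(x−ξ), δ(t−η)) dξ dη dt`,
where `F₁, F₃, F₄` are trivariate Mittag-Leffler type functions with the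
parameter lists `(β,1,β; 1,1,2; β,1,β+1; β,β; 1,2; 1,1; 1,1; 1,1)`,
`(β,1,β; 1,1,2; β,1,β; β,β; 1,2; 1,1; 1,1; 1,2)` and
`(β,1,β; 1,1,1; β,1,β; β,β; 1,1; 1,1; 1,1; 1,1)` respectively. -/
noncomputable def volterraRHS (β a b δ q : ℝ) (ψ φ M : ℝ → ℝ) (f : ℝ → ℝ → ℝ)
    (x : ℝ) : ℝ :=
  ψ x + Real.exp (b * x) * (∫ t in (0 : ℝ)..q, M t * (φ t - φ 0))
    - a * φ 0 * (∫ t in (0 : ℝ)..q, M t * t ^ β *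
        trivML β 1 β 1 1 2 β 1 (β + 1) β β 1 2 1 1 1 1 1 1
          (a * t ^ β) (b * x) (δ * t))
    + a * b * x * (∫ η in (0 : ℝ)..q, φ η * ∫ t in η..q, M t * (t - η) ^ (β - 1) *
        trivML β 1 β 1 1 2 β 1 β β β 1 2 1 1 1 1 1 2
          (a * (t - η) ^ β) (b * x) (δ * (t - η)))
    + ∫ t in (0 : ℝ)..q, M t * ∫ η in (0 : ℝ)..t, ∫ ξ in (0 : ℝ)..x,
        (t - η) ^ (β - 1) * f η ξ *
          trivML β 1 β 1 1 1 β 1 β β β 1 1 1 1 1 1 1 1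
            (a * (t - η) ^ β) (b * (x - ξ)) (δ * (t - η))

theorem gamma_lower {T s : ℝ} (hT : 0 < T) (hs : 1 ≤ s) :
    T ^ (s - 1) * Real.exp (-T) ≤ Real.Gamma s := by
  have hs0 : 0 < s := by linarith
  have hconv := Real.GammaIntegral_convergent hs0
  rw [Real.Gamma_eq_integral hs0]
  have h1 : ∫ x in Set.Ioi T, T ^ (s - 1) * Real.exp (-x) = T ^ (s - 1) * Real.exp (-T) := by
    rw [MeasureTheory.integral_const_mul, integral_exp_neg_Ioi]
  rw [← h1]
  have hsub : Set.Ioi T ⊆ Set.Ioi (0 : ℝ) := Set.Ioi_subset_Ioi hT.le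
  calc ∫ x in Set.Ioi T, T ^ (s - 1) * Real.exp (-x)
      ≤ ∫ x in Set.Ioi T, Real.exp (-x) * x ^ (s - 1) := by
        apply MeasureTheory.setIntegral_mono_on
        · exact (integrableOn_exp_neg_Ioi T).const_mul _
        · exact hconv.mono_set hsub
        · exact measurableSet_Ioi
        · intro x hx
          rw [mul_comm]
          have : T ^ (s - 1) ≤ x ^ (s - 1) :=
            Real.rpow_le_rpow hT.le (le_of_lt hx) (by linarith)
          exact mul_le_mul_of_nonneg_left this (Real.exp_pos _).le
    _ ≤ ∫ x in Set.Ioi 0, Real.exp (-x) * x ^ (s - 1) := by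
        apply MeasureTheory.setIntegral_mono_set hconv
        · filter_upwards [MeasureTheory.ae_restrict_mem measurableSet_Ioi] with x hx
          have : (0 : ℝ) < x := hx
          simp only [Pi.zero_apply]
          positivity
        · exact hsub.eventuallyLE

theorem summable_ml {β : ℝ} (hβ : 0 < β) {R : ℝ} (hR : 0 < R) :
    Summable fun m : ℕ => R ^ m / Real.Gamma (β * m + β) := by
  set T : ℝ := (2 * R) ^ (1 / β) with hTdef
  have hT : 0 < T := by positivity
  have hTβ : T ^ β = 2 * R := by
    rw [hTdef, ← Real.rpow_mul (by positivity)]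
    field_simp
    simp
  obtain ⟨N, hN⟩ := exists_nat_gt (1 / β)
  rw [← summable_nat_add_iff N]
  have hgeo : Summable fun n : ℕ => (Real.exp T * T ^ (1 - β)) * (1 / 2 : ℝ) ^ n :=
    (summable_geometric_of_lt_one (by norm_num) (by norm_num)).mul_left _
  have hgeo' := (summable_nat_add_iff N).2 hgeo
  refine Summable.of_nonneg_of_le ?_ ?_ hgeo'
  · intro n
    have : 0 < Real.Gamma (β * ((n + N : ℕ) : ℝ) + β) := Real.Gamma_pos_of_pos (by positivity)
    positivity
  · intro n
    generalize hm : n + N = m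
    have hmN : (N : ℝ) ≤ m := by
      rw [← hm]; push_cast; linarith [Nat.cast_nonneg (α := ℝ) n]
    have hbm : 1 ≤ β * m := by
      have := hN.trans_le hmN
      rw [div_lt_iff₀ hβ] at this
      nlinarith
    have hg := gamma_lower hT (s := β * m + β) (by linarith)
    have hgp : 0 < Real.Gamma (β * m + β) := Real.Gamma_pos_of_pos (by positivity)
    rw [div_le_iff₀ hgp]
    have e1 : T ^ (β * m + β - 1) = (2 * R) ^ m * T ^ (β - 1) := by
      rw [show β * m + β - 1 = β * m + (β - 1) by ring, Real.rpow_add hT, Real.rpow_mul hT.le, hTβ,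
        Real.rpow_natCast]
    have e2 : T ^ (1 - β) * T ^ (β - 1) = 1 := by
      rw [← Real.rpow_add hT]; simp
    have e3 : Real.exp T * Real.exp (-T) = 1 := by
      rw [← Real.exp_add]; simp
    have e4 : (1 / 2 : ℝ) ^ m * (2 * R) ^ m = R ^ m := by
      rw [← mul_pow]; congr 1; ring
    calc R ^ m = (Real.exp T * T ^ (1 - β)) * (1 / 2 : ℝ) ^ m *
        (T ^ (β * m + β - 1) * Real.exp (-T)) := by
          rw [e1]
          calc R ^ m = ((1 / 2 : ℝ) ^ m * (2 * R) ^ m) * (T ^ (1 - β) * T ^ (β - 1))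
            * (Real.exp T * Real.exp (-T)) := by rw [e2, e3, e4]; ring
            _ = _ := by ring
      _ ≤ _ := by
          apply mul_le_mul_of_nonneg_left hg
          positivity

theorem cont_series {β : ℝ} (hβ : 0 < β) (C : ℝ) (hC : 0 ≤ C) (c : ℕ × ℕ × ℕ → ℝ)
    (hc : ∀ i : ℕ × ℕ × ℕ, |c i| ≤ C * ((2 ^ i.1 / Real.Gamma (β * i.1 + β)) *
      ((2 ^ i.2.1 / (i.2.1.factorial : ℝ)) * (1 / (i.2.2.factorial : ℝ))))) :
    Continuous fun w : ℝ × ℝ × ℝ =>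
      ∑' i : ℕ × ℕ × ℕ, c i * w.1 ^ i.1 * w.2.1 ^ i.2.1 * w.2.2 ^ i.2.2 := by
  rw [continuous_iff_continuousAt]
  intro w0
  set R : ℝ := ‖w0‖ + 1 with hRdef
  have hR : 0 < R := by positivity
  have hnhds : Metric.ball (0 : ℝ × ℝ × ℝ) R ∈ nhds w0 := by
    apply Metric.isOpen_ball.mem_nhds
    simp [hRdef]
  refine ContinuousOn.continuousAt ?_ hnhds
  have hG : ∀ m : ℕ, 0 < Real.Gamma (β * m + β) := fun m => Real.Gamma_pos_of_pos (by positivity)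
  have s1 : Summable fun m : ℕ => (2 * R) ^ m / Real.Gamma (β * m + β) :=
    summable_ml hβ (by positivity)
  have s2 := Real.summable_pow_div_factorial (2 * R)
  have s3 := Real.summable_pow_div_factorial R
  have s23 := s2.mul_of_nonneg s3 (fun n => by simp only [Pi.zero_apply]; positivity)
    (fun n => by simp only [Pi.zero_apply]; positivity)
  have s := (s1.mul_of_nonneg s23
    (fun n => by have := hG n; simp only [Pi.zero_apply]; positivity)
    (fun n => by simp only [Pi.zero_apply]; positivity)).mul_left C
  refine continuousOn_tsum (fun i => by fun_prop) s ?_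
  rintro ⟨m, j, k⟩ ⟨x, y, z⟩ hw
  have hw' : ‖((x, y, z) : ℝ × ℝ × ℝ)‖ < R := by simpa using hw
  simp only [Prod.norm_def, max_lt_iff, Real.norm_eq_abs] at hw'
  obtain ⟨hx, hy, hz⟩ := hw'
  have hc' := hc (m, j, k)
  simp only at hc'
  have := hG m
  simp only [norm_mul, norm_pow, Real.norm_eq_abs]
  calc |c (m, j, k)| * |x| ^ m * |y| ^ j * |z| ^ k
      ≤ (C * ((2 ^ m / Real.Gamma (β * m + β)) *
      ((2 ^ j / (j.factorial : ℝ)) * (1 / (k.factorial : ℝ))))) * R ^ m * R ^ j * R ^ k := by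
        gcongr
    _ = _ := by
        rw [mul_pow, mul_pow]; ring

theorem fact_ratio (m j : ℕ) :
    ((m + j).factorial : ℝ) ≤ 2 ^ m * 2 ^ j * (m.factorial * j.factorial) := by
  have h := Nat.add_choose_mul_factorial_mul_factorial m j
  have h2 := Nat.choose_le_two_pow (m + j) j
  have : (m + j).factorial ≤ 2 ^ m * 2 ^ j * (m.factorial * j.factorial) := by
    rw [← h, ← pow_add, mul_assoc]
    exact Nat.mul_le_mul_right _ h2
  exact_mod_cast this

theorem cont_F4 {β : ℝ} (hβ : 0 < β) : Continuous fun w : ℝ × ℝ × ℝ =>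
    trivML β 1 β 1 1 1 β 1 β β β 1 1 1 1 1 1 1 1 w.1 w.2.1 w.2.2 := by
  have key := cont_series hβ 1 zero_le_one (fun i => 
    ((i.1 + i.2.1).factorial : ℝ) / (Real.Gamma (β * i.1 + β) * i.1.factorial *
      i.2.2.factorial * i.2.1.factorial * i.2.1.factorial)) ?_
  · refine key.congr ?_
    intro w
    unfold trivML
    refine tsum_congr ?_
    rintro ⟨m, j, k⟩
    simp only
    have h1 : Real.Gamma (β * m + 1 * k + β) ≠ 0 := (Real.Gamma_pos_of_pos (by positivity)).ne'
    have h2 : Real.Gamma (β * m + β) ≠ 0 := (Real.Gamma_pos_of_pos (by positivity)).ne'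
    have e1 : Real.Gamma (1 * m + 1 * j + 1) = (m + j).factorial := by
      rw [← Real.Gamma_nat_eq_factorial]; push_cast; ring_nf
    simp only [e1]
    simp only [one_mul, Real.Gamma_nat_eq_factorial] at h1 ⊢
    field_simp
  · rintro ⟨m, j, k⟩
    simp only
    have h2 : 0 < Real.Gamma (β * m + β) := Real.Gamma_pos_of_pos (by positivity)
    rw [abs_of_nonneg (by positivity), div_le_iff₀ (by positivity)]
    refine (fact_ratio m j).trans ?_
    have hj : (1 : ℝ) ≤ j.factorial := by exact_mod_cast Nat.one_le_iff_ne_zero.2 (Nat.factorial_ne_zero j)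
    apply le_of_eq
    field_simp

theorem cont_F3 {β : ℝ} (hβ : 0 < β) : Continuous fun w : ℝ × ℝ × ℝ =>
    trivML β 1 β 1 1 2 β 1 β β β 1 2 1 1 1 1 1 2 w.1 w.2.1 w.2.2 := by
  have key := cont_series hβ 2 zero_le_two (fun i => 
    ((i.1 + 1 + i.2.1).factorial : ℝ) / (Real.Gamma (β * i.1 + β) * (i.1 + 1).factorial *
      i.2.2.factorial * i.2.1.factorial * (i.2.1 + 1).factorial)) ?_
  · refine key.congr ?_
    intro w
    unfold trivML
    refine tsum_congr ?_
    rintro ⟨m, j, k⟩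
    simp only
    have h1 : Real.Gamma (β * m + 1 * k + β) ≠ 0 := (Real.Gamma_pos_of_pos (by positivity)).ne'
    have h2 : Real.Gamma (β * m + β) ≠ 0 := (Real.Gamma_pos_of_pos (by positivity)).ne'
    have e1 : Real.Gamma (1 * m + 1 * j + 2) = (m + 1 + j).factorial := by
      rw [← Real.Gamma_nat_eq_factorial]; push_cast; ring_nf
    have e2 : ∀ n : ℕ, Real.Gamma (1 * n + 2) = (n + 1).factorial := by
      intro n
      rw [← Real.Gamma_nat_eq_factorial]; push_cast; ring_nf
    simp only [e1, e2]
    simp only [one_mul, Real.Gamma_nat_eq_factorial] at h1 ⊢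
    field_simp
  · rintro ⟨m, j, k⟩
    simp only
    have h2 : 0 < Real.Gamma (β * m + β) := Real.Gamma_pos_of_pos (by positivity)
    rw [abs_of_nonneg (by positivity), div_le_iff₀ (by positivity)]
    refine (fact_ratio (m + 1) j).trans ?_
    have hj : (1 : ℝ) ≤ (j + 1).factorial := by
      exact_mod_cast Nat.one_le_iff_ne_zero.2 (Nat.factorial_ne_zero (j + 1))
    have hj' : (j.factorial : ℝ) ≤ (j + 1).factorial := by
      exact_mod_cast Nat.factorial_le (Nat.le_succ j)
    calc (2 : ℝ) ^ (m + 1) * 2 ^ j * ((m + 1).factorial * j.factorial)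
      ≤ (2 : ℝ) ^ (m + 1) * 2 ^ j * ((m + 1).factorial * (j + 1).factorial) := by gcongr
      _ = _ := by rw [pow_succ]; field_simp

theorem cont_F1 {β : ℝ} (hβ : 0 < β) : Continuous fun w : ℝ × ℝ × ℝ =>
    trivML β 1 β 1 1 2 β 1 (β + 1) β β 1 2 1 1 1 1 1 1 w.1 w.2.1 w.2.2 := by
  have key := cont_series hβ (2 / β) (by positivity) (fun i => 
    ((i.1 + 1 + i.2.1).factorial : ℝ) / ((β * i.1 + i.2.2 + β) *
      (Real.Gamma (β * i.1 + β) * (i.1 + 1).factorial *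
      i.2.2.factorial * i.2.1.factorial * i.2.1.factorial))) ?_
  · refine key.congr ?_
    intro w
    unfold trivML
    refine tsum_congr ?_
    rintro ⟨m, j, k⟩
    simp only
    have h0 : β * m + 1 * k + β ≠ 0 := by positivity
    have h1 : Real.Gamma (β * m + 1 * k + β) ≠ 0 := (Real.Gamma_pos_of_pos (by positivity)).ne'
    have h2 : Real.Gamma (β * m + β) ≠ 0 := (Real.Gamma_pos_of_pos (by positivity)).ne'
    have e1 : Real.Gamma (1 * m + 1 * j + 2) = (m + 1 + j).factorial := by
      rw [← Real.Gamma_nat_eq_factorial]; push_cast; ring_nf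
    have e2 : ∀ n : ℕ, Real.Gamma (1 * n + 2) = (n + 1).factorial := by
      intro n
      rw [← Real.Gamma_nat_eq_factorial]; push_cast; ring_nf
    have e3 : Real.Gamma (β * m + 1 * k + (β + 1)) =
        (β * m + 1 * k + β) * Real.Gamma (β * m + 1 * k + β) := by
      rw [← Real.Gamma_add_one h0]; ring_nf
    simp only [e1, e2, e3]
    simp only [one_mul, Real.Gamma_nat_eq_factorial] at h0 h1 ⊢
    field_simp
  · rintro ⟨m, j, k⟩
    simp only
    have h2 : 0 < Real.Gamma (β * m + β) := Real.Gamma_pos_of_pos (by positivity)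
    rw [abs_of_nonneg (by positivity), div_le_iff₀ (by positivity)]
    refine (fact_ratio (m + 1) j).trans ?_
    have hb : β ≤ β * m + k + β := by
      have : 0 ≤ β * m := by positivity
      have : (0 : ℝ) ≤ k := by positivity
      linarith
    calc (2 : ℝ) ^ (m + 1) * 2 ^ j * ((m + 1).factorial * j.factorial)
      = 2 / β * (2 ^ m / Real.Gamma (β * ↑m + β) *
        (2 ^ j / (j.factorial : ℝ) * (1 / (k.factorial : ℝ)))) * (β * (Real.Gamma (β * ↑m + β) *
        ((m + 1).factorial : ℝ) * (k.factorial : ℝ) * (j.factorial : ℝ) * (j.factorial : ℝ))) := by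
          rw [pow_succ]; field_simp
      _ ≤ _ := by gcongr

theorem cont_weighted {W : Type*} [TopologicalSpace W] [FirstCountableTopology W]
    [LocallyCompactSpace W] (w : ℝ → ℝ) (hw : IntervalIntegrable w MeasureTheory.volume 0 1)
    (H : W → ℝ → ℝ) (hH : Continuous (Function.uncurry H)) :
    Continuous fun x => ∫ u in (0 : ℝ)..1, w u * H x u := by
  rw [continuous_iff_continuousAt]
  intro x0
  obtain ⟨K, hK, hKn⟩ := exists_compact_mem_nhds x0
  obtain ⟨C, hC⟩ := (hK.prod (isCompact_Icc (a := (0 : ℝ)) (b := 1))).exists_bound_of_continuousOn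
    hH.continuousOn
  have hsec : ∀ x, Continuous (H x) := fun x => hH.comp (by fun_prop : Continuous fun u : ℝ => (x, u))
  refine intervalIntegral.continuousAt_of_dominated_interval
    (bound := fun u => |w u| * C) ?_ ?_ ?_ ?_
  · filter_upwards with x
    have h1 := hw.aestronglyMeasurable
    rw [Set.uIoc_of_le zero_le_one]
    exact h1.mul (hsec x).aestronglyMeasurable
  · filter_upwards [hKn] with x hx
    filter_upwards with u hu
    rw [Set.uIoc_of_le zero_le_one] at hu
    rw [norm_mul]
    exact mul_le_mul_of_nonneg_left (hC (x, u) ⟨hx, hu.1.le, hu.2⟩) (norm_nonneg _)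
  · exact hw.abs.mul_const C
  · filter_upwards with u hu
    have : Continuous fun x => H x u := hH.comp (by fun_prop : Continuous fun x : W => (x, u))
    exact (continuous_const.mul this).continuousAt

theorem beta_weight {r s : ℝ} (hr : 0 < r) (hs : 0 < s) :
    IntervalIntegrable (fun u : ℝ => u ^ (r - 1) * (1 - u) ^ (s - 1)) MeasureTheory.volume 0 1 := by
  have h := (Complex.betaIntegral_convergent (u := (r : ℂ)) (v := (s : ℂ)) (by simpa) (by simpa)).norm
  rw [intervalIntegrable_iff_integrableOn_Ioo_of_le zero_le_one] at h ⊢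
  refine h.congr_fun ?_ measurableSet_Ioo
  intro x hx
  have h1 : 0 < x := hx.1
  have h2 : 0 < 1 - x := by linarith [hx.2]
  simp only [norm_mul]
  rw [Complex.norm_cpow_eq_rpow_re_of_pos h1]
  have : (1 - (x : ℂ)) = ((1 - x : ℝ) : ℂ) := by push_cast; rfl
  rw [this, Complex.norm_cpow_eq_rpow_re_of_pos h2]
  simp

theorem ext_Icc {q : ℝ} (hq : 0 < q) (f : ℝ → ℝ) (hf : ContinuousOn f (Set.Icc 0 q)) :
    ∃ g : ℝ → ℝ, Continuous g ∧ ∀ t ∈ Set.Icc 0 q, f t = g t := by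
  refine ⟨fun t => f (Set.projIcc 0 q hq.le t), ?_, ?_⟩
  · exact hf.comp_continuous (continuous_subtype_val.comp continuous_projIcc)
      (fun t => (Set.projIcc 0 q hq.le t).2)
  · intro t ht
    simp [Set.projIcc_of_mem hq.le ht]

theorem ext_Icc2 {q p : ℝ} (hq : 0 < q) (hp : 0 < p) (f : ℝ → ℝ → ℝ)
    (hf : ContinuousOn (fun w : ℝ × ℝ => f w.1 w.2) (Set.Icc 0 q ×ˢ Set.Icc 0 p)) :
    ∃ g : ℝ × ℝ → ℝ, Continuous g ∧ ∀ t ∈ Set.Icc 0 q, ∀ x ∈ Set.Icc 0 p, f t x = g (t, x) := by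
  refine ⟨fun w => f (Set.projIcc 0 q hq.le w.1) (Set.projIcc 0 p hp.le w.2), ?_, ?_⟩
  · exact hf.comp_continuous (f := fun w : ℝ × ℝ =>
      (((Set.projIcc 0 q hq.le w.1 : ℝ)), ((Set.projIcc 0 p hp.le w.2 : ℝ))))
      ((continuous_subtype_val.comp (continuous_projIcc.comp continuous_fst)).prodMk
        (continuous_subtype_val.comp (continuous_projIcc.comp continuous_snd)))
      (fun t => ⟨(Set.projIcc 0 q hq.le t.1).2, (Set.projIcc 0 p hp.le t.2).2⟩)
  · intro t ht x hx
    simp [Set.projIcc_of_mem hq.le ht, Set.projIcc_of_mem hp.le hx]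

theorem term3 {β a b δ q : ℝ} (hβ : 0 < β) (hq : 0 < q) (M : ℝ → ℝ)
    (hM : ContinuousOn M (Set.Icc 0 q)) (F : ℝ → ℝ → ℝ → ℝ)
    (hF : Continuous fun w : ℝ × ℝ × ℝ => F w.1 w.2.1 w.2.2) :
    Continuous fun x : ℝ => ∫ t in (0 : ℝ)..q, M t * t ^ β * F (a * t ^ β) (b * x) (δ * t) := by
  obtain ⟨N, hN, hMN⟩ := ext_Icc hq M hM
  have hr := Real.continuous_rpow_const hβ.le
  have : Continuous fun x : ℝ =>
      ∫ t in (0 : ℝ)..q, N t * t ^ β * F (a * t ^ β) (b * x) (δ * t) := by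
    apply intervalIntegral.continuous_parametric_intervalIntegral_of_continuous'
    have h1 : Continuous fun z : ℝ × ℝ => z.2 ^ β := hr.comp continuous_snd
    have h2 : Continuous fun z : ℝ × ℝ => F (a * z.2 ^ β) (b * z.1) (δ * z.2) :=
      hF.comp (f := fun z : ℝ × ℝ => (a * z.2 ^ β, b * z.1, δ * z.2)) (by fun_prop)
    exact ((hN.comp continuous_snd).mul h1).mul h2
  refine this.congr ?_
  intro x
  apply intervalIntegral.integral_congr_Ioo_of_le hq.le
  intro t ht
  simp only
  rw [hMN t ⟨ht.1.le, ht.2.le⟩]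

theorem term4 {β a b δ q : ℝ} (hβ : 0 < β) (hq : 0 < q) (M φ : ℝ → ℝ)
    (hM : ContinuousOn M (Set.Icc 0 q)) (hφ : ContinuousOn φ (Set.Icc 0 q)) (F : ℝ → ℝ → ℝ → ℝ)
    (hF : Continuous fun w : ℝ × ℝ × ℝ => F w.1 w.2.1 w.2.2) :
    Continuous fun x : ℝ => ∫ η in (0 : ℝ)..q, φ η * ∫ t in η..q, M t * (t - η) ^ (β - 1) *
      F (a * (t - η) ^ β) (b * x) (δ * (t - η)) := by
  obtain ⟨N, hN, hMN⟩ := ext_Icc hq M hM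
  obtain ⟨χ, hχ, hφχ⟩ := ext_Icc hq φ hφ
  have hr := Real.continuous_rpow_const hβ.le
  set H : ℝ × ℝ → ℝ → ℝ := fun w u => N (w.2 + (q - w.2) * u) *
    F (a * ((q - w.2) * u) ^ β) (b * w.1) (δ * ((q - w.2) * u)) with hHdef
  have hH : Continuous (Function.uncurry H) := by
    have h0 : Continuous fun z : (ℝ × ℝ) × ℝ => ((q - z.1.2) * z.2) ^ β :=
      hr.comp (by fun_prop)
    have h1 : Continuous fun z : (ℝ × ℝ) × ℝ => F (a * ((q - z.1.2) * z.2) ^ β) (b * z.1.1)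
        (δ * ((q - z.1.2) * z.2)) :=
      hF.comp (f := fun z : (ℝ × ℝ) × ℝ => (a * ((q - z.1.2) * z.2) ^ β, b * z.1.1,
        δ * ((q - z.1.2) * z.2))) (by fun_prop)
    exact (hN.comp (f := fun z : (ℝ × ℝ) × ℝ => z.1.2 + (q - z.1.2) * z.2) (by fun_prop)).mul h1
  have hI := cont_weighted (fun u => u ^ (β - 1))
    (intervalIntegral.intervalIntegrable_rpow' (by linarith)) H hH
  have hmain : Continuous fun x : ℝ => ∫ η in (0 : ℝ)..q,
      χ η * ((q - η) ^ β * ∫ u in (0 : ℝ)..1, u ^ (β - 1) * H (x, η) u) := by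
    apply intervalIntegral.continuous_parametric_intervalIntegral_of_continuous'
    have h1 : Continuous fun z : ℝ × ℝ => (q - z.2) ^ β := hr.comp (by fun_prop)
    exact (hχ.comp continuous_snd).mul (h1.mul hI)
  refine hmain.congr ?_
  intro x
  apply intervalIntegral.integral_congr_Ioo_of_le hq.le
  intro η hη
  have hqη : 0 < q - η := by linarith [hη.2]
  simp only
  rw [hφχ η ⟨hη.1.le, hη.2.le⟩]
  congr 1
  have hsub := intervalIntegral.mul_integral_comp_add_mul (a := 0) (b := 1)
    (f := fun t => M t * (t - η) ^ (β - 1) *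
      F (a * (t - η) ^ β) (b * x) (δ * (t - η))) (q - η) η
  simp only [mul_zero, add_zero, mul_one, add_sub_cancel, add_sub_cancel_left] at hsub
  rw [← hsub, ← intervalIntegral.integral_const_mul, ← intervalIntegral.integral_const_mul]
  apply intervalIntegral.integral_congr_Ioo_of_le zero_le_one
  intro u hu
  have hu0 : 0 < u := hu.1
  simp only [hHdef]
  rw [hMN (η + (q - η) * u) ⟨by have := hη.1; positivity, by nlinarith [hu.2]⟩,
    Real.mul_rpow (z := β - 1) hqη.le hu0.le, Real.rpow_sub_one hqη.ne']
  field_simp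

theorem term5 {β a b δ q p ε₁ ε₂ : ℝ} (hβ : 0 < β) (hq : 0 < q) (hp : 0 < p)
    (hε₁ : ε₁ < β) (hβ1 : β < 1) (hε₂ : ε₂ < 1) (M : ℝ → ℝ) (ftil : ℝ → ℝ → ℝ)
    (hM : ContinuousOn M (Set.Icc 0 q))
    (hftil : ContinuousOn (fun w : ℝ × ℝ => ftil w.1 w.2) (Set.Icc 0 q ×ˢ Set.Icc 0 p))
    (F : ℝ → ℝ → ℝ → ℝ)
    (hF : Continuous fun w : ℝ × ℝ × ℝ => F w.1 w.2.1 w.2.2) :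
    ContinuousOn (fun x : ℝ => ∫ t in (0 : ℝ)..q, M t * ∫ η in (0 : ℝ)..t, ∫ ξ in (0 : ℝ)..x,
        (t - η) ^ (β - 1) * (η ^ (-ε₁) * ξ ^ (-ε₂) * ftil η ξ) *
          F (a * (t - η) ^ β) (b * (x - ξ)) (δ * (t - η))) (Set.Icc 0 p) := by
  obtain ⟨N, hN, hMN⟩ := ext_Icc hq M hM
  obtain ⟨G, hG, hfG⟩ := ext_Icc2 hq hp ftil hftil
  have hr := Real.continuous_rpow_const hβ.le
  -- parameters ((x, t), u), inner variable v
  set H : (ℝ × ℝ) × ℝ → ℝ → ℝ := fun w v => G (w.1.2 * w.2, w.1.1 * v) *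
    F (a * (w.1.2 * (1 - w.2)) ^ β) (b * (w.1.1 * (1 - v))) (δ * (w.1.2 * (1 - w.2))) with hHdef
  have hH : Continuous (Function.uncurry H) := by
    have h0 : Continuous fun z : ((ℝ × ℝ) × ℝ) × ℝ => (z.1.1.2 * (1 - z.1.2)) ^ β :=
      hr.comp (by fun_prop)
    have h1 : Continuous fun z : ((ℝ × ℝ) × ℝ) × ℝ => F (a * (z.1.1.2 * (1 - z.1.2)) ^ β)
        (b * (z.1.1.1 * (1 - z.2))) (δ * (z.1.1.2 * (1 - z.1.2))) :=
      hF.comp (f := fun z : ((ℝ × ℝ) × ℝ) × ℝ => (a * (z.1.1.2 * (1 - z.1.2)) ^ β,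
        b * (z.1.1.1 * (1 - z.2)), δ * (z.1.1.2 * (1 - z.1.2)))) (by fun_prop)
    exact (hG.comp (f := fun z : ((ℝ × ℝ) × ℝ) × ℝ => (z.1.1.2 * z.1.2, z.1.1.1 * z.2))
      (by fun_prop)).mul h1
  have hP := cont_weighted (fun v => v ^ (-ε₂))
    (intervalIntegral.intervalIntegrable_rpow' (by linarith)) H hH
  have hQ := cont_weighted (W := ℝ × ℝ) (fun u => u ^ ((1 - ε₁) - 1) * (1 - u) ^ (β - 1))
    (beta_weight (by linarith) hβ)
    (fun w u => ∫ v in (0 : ℝ)..1, v ^ (-ε₂) * H (w, u) v) hP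
  have hmain : Continuous fun x : ℝ => x ^ (1 - ε₂) * ∫ t in (0 : ℝ)..q,
      N t * (t ^ (β - ε₁) * ∫ u in (0 : ℝ)..1, u ^ ((1 - ε₁) - 1) * (1 - u) ^ (β - 1) *
        ∫ v in (0 : ℝ)..1, v ^ (-ε₂) * H ((x, t), u) v) := by
    refine (Real.continuous_rpow_const (by linarith)).mul ?_
    apply intervalIntegral.continuous_parametric_intervalIntegral_of_continuous'
    have h1 : Continuous fun z : ℝ × ℝ => z.2 ^ (β - ε₁) :=
      (Real.continuous_rpow_const (by linarith)).comp continuous_snd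
    exact (hN.comp continuous_snd).mul (h1.mul hQ)
  refine hmain.continuousOn.congr ?_
  intro x hx
  simp only
  rcases hx.1.eq_or_lt with hx0 | hx0
  · subst hx0
    simp [Real.zero_rpow (by linarith : 1 - ε₂ ≠ 0)]
  rw [← intervalIntegral.integral_const_mul]
  apply intervalIntegral.integral_congr_Ioo_of_le hq.le
  intro t ht
  have ht0 : 0 < t := ht.1
  simp only
  rw [hMN t ⟨ht.1.le, ht.2.le⟩, mul_left_comm]
  congr 1
  have hsub := intervalIntegral.mul_integral_comp_mul_left (a := 0) (b := 1)
    (f := fun η => ∫ ξ in (0 : ℝ)..x,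
        (t - η) ^ (β - 1) * (η ^ (-ε₁) * ξ ^ (-ε₂) * ftil η ξ) *
          F (a * (t - η) ^ β) (b * (x - ξ)) (δ * (t - η))) t
  simp only [mul_zero, mul_one] at hsub
  rw [← hsub, ← intervalIntegral.integral_const_mul, ← intervalIntegral.integral_const_mul,
    ← intervalIntegral.integral_const_mul]
  apply intervalIntegral.integral_congr_Ioo_of_le zero_le_one
  intro u hu
  have hu0 : 0 < u := hu.1
  have hu1 : 0 < 1 - u := by linarith [hu.2]
  simp only
  have hsub2 := intervalIntegral.mul_integral_comp_mul_left (a := 0) (b := 1)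
    (f := fun ξ => (t - t * u) ^ (β - 1) * ((t * u) ^ (-ε₁) * ξ ^ (-ε₂) * ftil (t * u) ξ) *
          F (a * (t - t * u) ^ β) (b * (x - ξ)) (δ * (t - t * u))) x
  simp only [mul_zero, mul_one] at hsub2
  rw [← hsub2]
  simp only [← intervalIntegral.integral_const_mul]
  apply intervalIntegral.integral_congr_Ioo_of_le zero_le_one
  intro v hv
  have hv0 : 0 < v := hv.1
  simp only [hHdef]
  rw [hfG (t * u) ⟨by positivity, by nlinarith [ht.2]⟩ (x * v)
    ⟨by positivity, by nlinarith [hx.2, hv.2]⟩]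
  rw [show t - t * u = t * (1 - u) by ring, show x - x * v = x * (1 - v) by ring,
    Real.mul_rpow (z := β - 1) ht0.le hu1.le, Real.mul_rpow (z := -ε₁) ht0.le hu0.le,
    Real.mul_rpow (z := -ε₂) hx0.le hv0.le]
  rw [show 1 - ε₁ - 1 = -ε₁ by ring, show 1 - ε₂ = 1 + -ε₂ by ring, Real.rpow_add hx0,
    show β - ε₁ = 1 + (β - 1) + -ε₁ by ring, Real.rpow_add ht0, Real.rpow_add ht0]
  simp only [Real.rpow_one]
  ring

/-- for `0 < β < 1`, `a, b, δ < 0`, `q, p > 0`, continuous data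
`ψ ∈ C[0,p]`, `φ, M ∈ C[0,q]` and `f(t,x) = t^{−ε₁} x^{−ε₂} f̃(t,x)` with `f̃`
continuous on `[0,q]×[0,p]`, `0 ≤ ε₁ < β`, `0 ≤ ε₂ < 1`, the right-hand side
`g` is continuous on `[0,p]`, and in particular bounded by some `C₃ > 0`. -/
theorem volterraRHS_continuous_and_bounded (β a b δ q p ε₁ ε₂ : ℝ)
    (hβ₀ : 0 < β) (hβ₁ : β < 1) (ha : a < 0) (hb : b < 0) (hδ : δ < 0)
    (hq : 0 < q) (hp : 0 < p)
    (hε₁0 : 0 ≤ ε₁) (hε₁ : ε₁ < β) (hε₂0 : 0 ≤ ε₂) (hε₂ : ε₂ < 1)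
    (ψ φ M : ℝ → ℝ) (ftil : ℝ → ℝ → ℝ)
    (hψ : ContinuousOn ψ (Set.Icc 0 p))
    (hφ : ContinuousOn φ (Set.Icc 0 q))
    (hM : ContinuousOn M (Set.Icc 0 q))
    (hftil : ContinuousOn (fun w : ℝ × ℝ => ftil w.1 w.2)
      (Set.Icc 0 q ×ˢ Set.Icc 0 p)) :
    ContinuousOn
        (volterraRHS β a b δ q ψ φ M
          (fun t x => t ^ (-ε₁) * x ^ (-ε₂) * ftil t x))
        (Set.Icc 0 p) ∧
      ∃ C₃ > 0, ∀ x ∈ Set.Icc (0 : ℝ) p,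
        |volterraRHS β a b δ q ψ φ M
            (fun t x => t ^ (-ε₁) * x ^ (-ε₂) * ftil t x) x| ≤ C₃ := by
  have hcont : ContinuousOn
        (volterraRHS β a b δ q ψ φ M
          (fun t x => t ^ (-ε₁) * x ^ (-ε₂) * ftil t x))
        (Set.Icc 0 p) := by
    have h3 := term3 (a := a) (b := b) (δ := δ) hβ₀ hq M hM _ (cont_F1 hβ₀)
    have h4 := term4 (a := a) (b := b) (δ := δ) hβ₀ hq M φ hM hφ _ (cont_F3 hβ₀)
    have h5 := term5 (a := a) (b := b) (δ := δ) hβ₀ hq hp hε₁ hβ₁ hε₂ M ftil hM hftil _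
      (cont_F4 hβ₀)
    have h2 : Continuous fun x : ℝ => Real.exp (b * x) := by fun_prop
    have h6 : Continuous fun x : ℝ => a * b * x := by fun_prop
    exact (((hψ.add (h2.mul continuous_const).continuousOn).sub
      (continuous_const.mul h3).continuousOn).add (h6.mul h4).continuousOn).add h5
  refine ⟨hcont, ?_⟩
  obtain ⟨C, hC⟩ := isCompact_Icc.exists_bound_of_continuousOn hcont
  refine ⟨max C 1, by positivity, fun x hx => ?_⟩
  exact (hC x hx).trans (le_max_left _ _)
end
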